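/- arXiv:math/0311080 — 3 statements merged into one kernel-verified Lean document; each statement's English description precedes it below -/
import Mathlib

section
/- Let m, n, k be nonnegative integers, let S₁ = [[K₁, L₁],[L₁ᵗ, M₁]] be a symmetric (k+n)×(k+n) complex matrix (K₁ of size k×k, M₁ of size n×n) with −Re S₁ positive definite, and let S₂ = [[K₂, L₂],[L₂ᵗ, M₂]] be a symmetric (n+m)×(n+m) complex matrix (K₂ of size n×n, M₂ of size m×m) with −Re S₂ positive definite. Set S₃ = [[K₁ − L₁(M₁+K₂)⁻¹L₁ᵗ, −L₁(M₁+K₂)⁻¹L₂],[−L₂ᵗ(M₁+K₂)⁻¹L₁ᵗ, M₂ − L₂ᵗ(M₁+K₂)⁻¹L₂]]. Then there exists λ ∈ ℂ with λ² = det(−M₁−K₂)⁻¹ such that for all x ∈ ℝᵏ and z ∈ ℝᵐ: (2π)^{−n/2} ∫_{ℝⁿ} exp{½ (xᵗ, yᵗ) S₁ (x, y)ᵗ} · exp{½ (yᵗ, zᵗ) S₂ (y, z)ᵗ} dy = λ · exp{½ (xᵗ, zᵗ) S₃ (x, z)ᵗ}. -/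
open Matrix MeasureTheory Real

noncomputable section

/-- Complexification of a real vector. -/
def cv {ι : Type*} (x : ι → ℝ) : ι → ℂ := fun i => (x i : ℂ)

/-- The value `(xᵗ, yᵗ) S (x, y)ᵗ` of the quadratic form of a complex
`(m+n)×(m+n)` matrix `S` on the concatenated real vector `(x, y)`. -/
def qf {m n : ℕ} (S : Matrix (Fin m ⊕ Fin n) (Fin m ⊕ Fin n) ℂ)
    (x : Fin m → ℝ) (y : Fin n → ℝ) : ℂ :=
  dotProduct (cv (Sum.elim x y)) (S.mulVec (cv (Sum.elim x y)))

lemma real_diag {n : ℕ} {A : Matrix (Fin n) (Fin n) ℝ} (hA : A.IsHermitian) :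
    ∃ U : Matrix (Fin n) (Fin n) ℝ, Uᵀ * U = 1 ∧ Uᵀ * A * U = diagonal hA.eigenvalues := by
  refine ⟨hA.eigenvectorUnitary, ?_, ?_⟩
  · have := Unitary.coe_star_mul_self hA.eigenvectorUnitary
    simpa [star_eq_conjTranspose] using this
  · have := hA.conjStarAlgAut_star_eigenvectorUnitary
    rw [Unitary.conjStarAlgAut_star_apply] at this
    simpa [star_eq_conjTranspose, Function.comp_def] using this

lemma simul_diag {n : ℕ} {P Q : Matrix (Fin n) (Fin n) ℝ} (hP : P.PosDef) (hQ : Qᵀ = Q) :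
    ∃ (T : Matrix (Fin n) (Fin n) ℝ) (d : Fin n → ℝ), Tᵀ * P * T = 1 ∧
      Tᵀ * Q * T = diagonal d := by
  obtain ⟨U, hU, hUP⟩ := real_diag hP.1
  set p := hP.1.eigenvalues with hp
  have hpp : ∀ i, 0 < p i := hP.eigenvalues_pos
  let D : Matrix (Fin n) (Fin n) ℝ := diagonal fun i => (√(p i))⁻¹
  have hD : Dᵀ = D := by simp [D]
  have hQ' : (Dᵀ * (Uᵀ * Q * U) * D).IsHermitian := by
    simp only [IsHermitian, conjTranspose_eq_transpose_of_trivial, transpose_mul,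
      transpose_transpose, hQ, Matrix.mul_assoc]
  obtain ⟨V, hV, hVQ⟩ := real_diag hQ'
  refine ⟨U * D * V, _, ?_, Eq.trans ?_ hVQ⟩
  · have h1 : D * (Uᵀ * P * U) * D = 1 := by
      rw [hUP]
      simp only [D, diagonal_mul_diagonal]
      rw [← diagonal_one]
      congr 1
      ext i
      have := Real.mul_self_sqrt (hpp i).le
      have h2 := (Real.sqrt_pos.2 (hpp i)).ne'
      field_simp
      rw [sq, this]
    calc (U * D * V)ᵀ * P * (U * D * V) = Vᵀ * (D * (Uᵀ * P * U) * D) * V := by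
          simp only [transpose_mul, hD, Matrix.mul_assoc]
      _ = 1 := by rw [h1, Matrix.mul_one, hV]
  · simp only [transpose_mul, Matrix.mul_assoc]

lemma cplx_diag {n : ℕ} {A : Matrix (Fin n) (Fin n) ℂ} (hA : Aᵀ = A)
    (hP : (A.map Complex.re).PosDef) :
    ∃ (T : Matrix (Fin n) (Fin n) ℝ) (d : Fin n → ℂ), T.det ≠ 0 ∧ (∀ i, (d i).re = 1) ∧
      (T.map Complex.ofReal)ᵀ * A * (T.map Complex.ofReal) = diagonal d := by
  have hQ : (A.map Complex.im)ᵀ = A.map Complex.im := by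
    rw [← transpose_map, hA]
  obtain ⟨T, d, h1, h2⟩ := simul_diag hP hQ
  refine ⟨T, fun i => 1 + d i * Complex.I, ?_, by simp, ?_⟩
  · intro h0
    have := congrArg det h1
    simp [h0] at this
  · have hAe : A = (A.map Complex.re).map Complex.ofReal +
        Complex.I • (A.map Complex.im).map Complex.ofReal := by
      ext i j
      simp [mul_comm Complex.I, Complex.re_add_im]
    have h1' := congrArg (fun M => M.map Complex.ofRealHom) h1
    have h2' := congrArg (fun M => M.map Complex.ofRealHom) h2
    simp only [Matrix.map_mul, transpose_map] at h1' h2'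
    change (T.map Complex.ofReal)ᵀ * ((A.map Complex.re).map Complex.ofReal) * (T.map Complex.ofReal) = _ at h1'
    change (T.map Complex.ofReal)ᵀ * ((A.map Complex.im).map Complex.ofReal) * (T.map Complex.ofReal) = _ at h2'
    rw [hAe, Matrix.mul_add, Matrix.add_mul, Matrix.mul_smul, Matrix.smul_mul, h1', h2']
    ext i j
    by_cases hij : i = j
    · subst hij; simp [mul_comm]
    · simp [hij]

lemma integral_mulVec {n : ℕ} {T : Matrix (Fin n) (Fin n) ℝ} (hT : T.det ≠ 0)
    (f : (Fin n → ℝ) → ℂ) :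
    ∫ y, f y = (|T.det| : ℝ) * ∫ u, f (T *ᵥ u) := by
  have h := Real.map_matrix_volume_pi_eq_smul_volume_pi hT
  have he : MeasurableEmbedding (toLin' T) := by
    have : Function.Injective (toLin' T) := by
      have : IsUnit T := (Matrix.isUnit_iff_isUnit_det T).2 hT.isUnit
      exact Matrix.mulVec_injective_of_isUnit this
    exact (LinearMap.isClosedEmbedding_of_injective (LinearMap.ker_eq_bot.2 this)).measurableEmbedding
  have h2 := he.integral_map (μ := volume) f
  rw [h, integral_smul_measure] at h2
  simp only [toLin'_apply] at h2
  rw [← h2, ENNReal.toReal_ofReal (abs_nonneg _), Complex.real_smul, ← mul_assoc, ← Complex.ofReal_mul, ← abs_mul,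
    mul_inv_cancel₀ hT]
  simp

lemma gauss_aux {n : ℕ} {A : Matrix (Fin n) (Fin n) ℂ} (hA : Aᵀ = A)
    (hP : (A.map Complex.re).PosDef) :
    IsUnit A.det ∧ ∃ c : ℂ, c ^ 2 = (A.det)⁻¹ ∧ ∀ b : Fin n → ℂ,
      (((2 * π) ^ (-((n : ℝ) / 2)) : ℝ) : ℂ) *
        ∫ y : Fin n → ℝ, Complex.exp (-((1 / 2 : ℂ) * (cv y ⬝ᵥ A *ᵥ cv y)) + b ⬝ᵥ cv y)
      = c * Complex.exp ((1 / 2 : ℂ) * (b ⬝ᵥ A⁻¹ *ᵥ b)) := by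
  obtain ⟨T, d, hT, hd, hTA⟩ := cplx_diag hA hP
  set W := T.map Complex.ofReal with hW
  have hWdet : W.det = (T.det : ℂ) := by
    exact (RingHom.map_det Complex.ofRealHom T).symm
  have hW0 : W.det ≠ 0 := by rw [hWdet]; exact_mod_cast hT
  have hd0 : ∀ i, d i ≠ 0 := fun i h => by have := hd i; simp [h] at this
  have hdet : W.det * A.det * W.det = ∏ i, d i := by
    have := congrArg det hTA
    simpa [det_mul, det_transpose] using this
  have hprod : ∏ i, d i ≠ 0 := Finset.prod_ne_zero_iff.2 fun i _ => hd0 i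
  have hA0 : A.det ≠ 0 := by
    intro h; rw [h] at hdet; simp at hdet; exact hprod hdet.symm
  have hWu : IsUnit W.det := hW0.isUnit
  have hWtu : IsUnit Wᵀ.det := by rw [det_transpose]; exact hWu
  have hinv : A⁻¹ = W * diagonal (fun i => (d i)⁻¹) * Wᵀ := by
    apply Matrix.inv_eq_left_inv
    have h1 : diagonal (fun i => (d i)⁻¹) * (Wᵀ * A * W) = 1 := by
      rw [hTA, diagonal_mul_diagonal, ← diagonal_one]
      congr 1; ext i; exact inv_mul_cancel₀ (hd0 i)
    have h2 : W * (diagonal (fun i => (d i)⁻¹) * (Wᵀ * A * W)) * W⁻¹ = 1 := by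
      rw [h1, Matrix.mul_one, Matrix.mul_nonsing_inv _ hWu]
    calc _ = W * (diagonal (fun i => (d i)⁻¹) * (Wᵀ * A * (W * W⁻¹))) := by
          rw [Matrix.mul_nonsing_inv _ hWu]; simp only [Matrix.mul_assoc, Matrix.mul_one]
      _ = 1 := by rw [← h2]; simp only [Matrix.mul_assoc]
  refine ⟨hA0.isUnit, (((2 * π) ^ (-((n : ℝ) / 2)) : ℝ) : ℂ) * ((|T.det| : ℝ) *
      ∏ i, (π / (d i / 2)) ^ (1 / 2 : ℂ)), ?_, ?_⟩
  · have e1 : ((((2 * π) ^ (-((n : ℝ) / 2)) : ℝ) : ℂ)) ^ 2 = ((2 * π : ℂ) ^ n)⁻¹ := by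
      rw [← Complex.ofReal_pow, ← Real.rpow_natCast, ← Real.rpow_mul (by positivity)]
      rw [show -((n : ℝ) / 2) * ((2 : ℕ) : ℝ) = -(n : ℝ) by push_cast; ring,
        Real.rpow_neg (by positivity), Real.rpow_natCast]
      push_cast; rfl
    have e2 : ((|T.det| : ℝ) : ℂ) ^ 2 = W.det ^ 2 := by
      rw [← Complex.ofReal_pow, sq_abs, hWdet]; push_cast; rfl
    have e3 : (∏ i, (π / (d i / 2)) ^ (1 / 2 : ℂ)) ^ 2 = (2 * π : ℂ) ^ n * (∏ i, d i)⁻¹ := by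
      rw [← Finset.prod_pow, ← Finset.prod_inv_distrib]
      have : (2 * π : ℂ) ^ n = ∏ i : Fin n, (2 * π : ℂ) := by simp
      rw [this, ← Finset.prod_mul_distrib]
      refine Finset.prod_congr rfl fun i _ => ?_
      rw [← Complex.cpow_nat_mul]
      norm_num
      have := hd0 i
      field_simp
    rw [mul_pow, mul_pow, e1, e2, e3, ← hdet]
    have : (2 * π : ℂ) ^ n ≠ 0 := by
      apply pow_ne_zero
      simp [Real.pi_ne_zero]
    field_simp
  · intro b
    rw [integral_mulVec hT]
    have hcv : ∀ u : Fin n → ℝ, cv (T *ᵥ u) = W *ᵥ cv u := by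
      intro u; ext i
      simp [cv, hW, mulVec, dotProduct]
    have hint : ∀ u : Fin n → ℝ,
        -((1 / 2 : ℂ) * (cv (T *ᵥ u) ⬝ᵥ A *ᵥ cv (T *ᵥ u))) + b ⬝ᵥ cv (T *ᵥ u)
        = -∑ i, (d i / 2) * (u i : ℂ) ^ 2 + ∑ i, (b ᵥ* W) i * u i := by
      intro u
      rw [hcv, dotProduct_mulVec b]
      have : (W *ᵥ cv u) ⬝ᵥ A *ᵥ (W *ᵥ cv u) = cv u ⬝ᵥ (diagonal d) *ᵥ cv u := by
        rw [← hTA, ← vecMul_transpose, ← dotProduct_mulVec, mulVec_mulVec, vecMul_transpose,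
          mulVec_mulVec]
      rw [this]
      congr 1
      congr 1
      simp only [dotProduct, mulVec_diagonal, Finset.mul_sum, cv]
      exact Finset.sum_congr rfl fun i _ => by ring
    simp_rw [hint]
    rw [GaussianFourier.integral_cexp_neg_sum_mul_add (fun i => by simp [hd]), Finset.prod_mul_distrib,
      ← Complex.exp_sum]
    have : ∑ i, (b ᵥ* W) i ^ 2 / (4 * (d i / 2)) = (1 / 2 : ℂ) * (b ⬝ᵥ A⁻¹ *ᵥ b) := by
      rw [hinv, ← mulVec_mulVec, ← mulVec_mulVec, dotProduct_mulVec, mulVec_transpose]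
      simp only [dotProduct, mulVec_diagonal, Finset.mul_sum]
      refine Finset.sum_congr rfl fun i _ => ?_
      have := hd0 i
      field_simp
      norm_num
    rw [this]
    ring

lemma qf_fromBlocks {m n : ℕ} (K : Matrix (Fin m) (Fin m) ℂ) (L : Matrix (Fin m) (Fin n) ℂ)
    (L' : Matrix (Fin n) (Fin m) ℂ) (M : Matrix (Fin n) (Fin n) ℂ) (x : Fin m → ℝ)
    (y : Fin n → ℝ) : qf (fromBlocks K L L' M) x y =
      cv x ⬝ᵥ K *ᵥ cv x + cv x ⬝ᵥ L *ᵥ cv y + (cv y ⬝ᵥ L' *ᵥ cv x + cv y ⬝ᵥ M *ᵥ cv y) := by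
  have : cv (Sum.elim x y) = Sum.elim (cv x) (cv y) := by
    ext i; cases i <;> rfl
  rw [qf, this, fromBlocks_mulVec]
  simp [sumElim_dotProduct_sumElim, dotProduct_add]

/-- the Gaussian-integral composition identity
`(2π)^{−n/2} ∫ exp{½(xᵗ,yᵗ)S₁(x,y)ᵗ} exp{½(yᵗ,zᵗ)S₂(y,z)ᵗ} dy = λ exp{½(xᵗ,zᵗ)S₃(x,z)ᵗ}`
with `λ² = det(−M₁−K₂)⁻¹`. -/
theorem gauss_integral_comp (m n k : ℕ)
    (K₁ : Matrix (Fin k) (Fin k) ℂ) (L₁ : Matrix (Fin k) (Fin n) ℂ)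
    (M₁ : Matrix (Fin n) (Fin n) ℂ)
    (K₂ : Matrix (Fin n) (Fin n) ℂ) (L₂ : Matrix (Fin n) (Fin m) ℂ)
    (M₂ : Matrix (Fin m) (Fin m) ℂ)
    (S₁ : Matrix (Fin k ⊕ Fin n) (Fin k ⊕ Fin n) ℂ)
    (S₂ : Matrix (Fin n ⊕ Fin m) (Fin n ⊕ Fin m) ℂ)
    (S₃ : Matrix (Fin k ⊕ Fin m) (Fin k ⊕ Fin m) ℂ)
    (hS₁ : S₁ = Matrix.fromBlocks K₁ L₁ L₁ᵀ M₁)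
    (hS₂ : S₂ = Matrix.fromBlocks K₂ L₂ L₂ᵀ M₂)
    (hS₃ : S₃ = Matrix.fromBlocks
      (K₁ - L₁ * (M₁ + K₂)⁻¹ * L₁ᵀ) (-(L₁ * (M₁ + K₂)⁻¹ * L₂))
      (-(L₂ᵀ * (M₁ + K₂)⁻¹ * L₁ᵀ)) (M₂ - L₂ᵀ * (M₁ + K₂)⁻¹ * L₂))
    (hsym₁ : S₁ᵀ = S₁) (hsym₂ : S₂ᵀ = S₂)
    (hpos₁ : (-(S₁.map Complex.re)).PosDef)
    (hpos₂ : (-(S₂.map Complex.re)).PosDef) :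
    ∃ lam : ℂ, lam ^ 2 = ((-(M₁ + K₂)).det)⁻¹ ∧
      ∀ (x : Fin k → ℝ) (z : Fin m → ℝ),
        (((2 * π) ^ (-((n : ℝ) / 2)) : ℝ) : ℂ) *
          ∫ y : Fin n → ℝ,
            Complex.exp ((1 / 2 : ℂ) * qf S₁ x y) *
              Complex.exp ((1 / 2 : ℂ) * qf S₂ y z)
        = lam * Complex.exp ((1 / 2 : ℂ) * qf S₃ x z) := by
  subst hS₁ hS₂ hS₃
  rw [fromBlocks_transpose, fromBlocks_inj] at hsym₁ hsym₂
  have hM₁ := hsym₁.2.2.2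
  have hK₂ := hsym₂.1
  have hA : (-(M₁ + K₂))ᵀ = -(M₁ + K₂) := by
    rw [transpose_neg, transpose_add, hM₁, hK₂]
  have hP : ((-(M₁ + K₂)).map Complex.re).PosDef := by
    have h1 := hpos₁.submatrix (e := Sum.inr) Sum.inr_injective
    have h2 := hpos₂.submatrix (e := Sum.inl) Sum.inl_injective
    convert h1.add h2 using 1
    ext i j
    simp [add_comm]
  obtain ⟨hu, c, hc, hI⟩ := gauss_aux hA hP
  refine ⟨c, hc, fun x z => ?_⟩
  have hninv : (-(M₁ + K₂))⁻¹ = -(M₁ + K₂)⁻¹ := by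
    apply Matrix.inv_eq_left_inv
    rw [_root_.neg_mul_neg]
    apply Matrix.nonsing_inv_mul
    rw [det_neg] at hu
    exact isUnit_of_mul_isUnit_right hu
  have hb := hI (L₁ᵀ *ᵥ cv x + L₂ *ᵥ cv z)
  set E := (1 / 2 : ℂ) * (cv x ⬝ᵥ K₁ *ᵥ cv x + cv z ⬝ᵥ M₂ *ᵥ cv z) with hE
  have key : ∀ y : Fin n → ℝ, Complex.exp ((1 / 2 : ℂ) * qf (fromBlocks K₁ L₁ L₁ᵀ M₁) x y) *
        Complex.exp ((1 / 2 : ℂ) * qf (fromBlocks K₂ L₂ L₂ᵀ M₂) y z)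
      = Complex.exp E * Complex.exp (-((1 / 2 : ℂ) * (cv y ⬝ᵥ (-(M₁ + K₂)) *ᵥ cv y)) +
        (L₁ᵀ *ᵥ cv x + L₂ *ᵥ cv z) ⬝ᵥ cv y) := by
    intro y
    rw [← Complex.exp_add, ← Complex.exp_add]
    congr 1
    rw [qf_fromBlocks, qf_fromBlocks, hE]
    have e1 : cv x ⬝ᵥ L₁ *ᵥ cv y = cv y ⬝ᵥ L₁ᵀ *ᵥ cv x := by
      rw [dotProduct_mulVec, dotProduct_comm, mulVec_transpose]
    have e2 : cv z ⬝ᵥ L₂ᵀ *ᵥ cv y = cv y ⬝ᵥ L₂ *ᵥ cv z := by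
      rw [mulVec_transpose, dotProduct_comm, dotProduct_mulVec]
    rw [e1, e2, dotProduct_comm _ (cv y), dotProduct_add, neg_mulVec, add_mulVec, dotProduct_neg,
      dotProduct_add]
    ring
  simp_rw [key]
  rw [integral_const_mul, mul_left_comm, hb, mul_left_comm, ← Complex.exp_add]
  congr 2
  rw [qf_fromBlocks, hninv, hE]
  have e3 : ∀ v : Fin n → ℂ, (L₁ᵀ *ᵥ cv x) ⬝ᵥ v = cv x ⬝ᵥ L₁ *ᵥ v := by
    intro v; rw [mulVec_transpose, dotProduct_mulVec]
  have e4 : ∀ v : Fin n → ℂ, (L₂ *ᵥ cv z) ⬝ᵥ v = cv z ⬝ᵥ L₂ᵀ *ᵥ v := by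
    intro v; rw [dotProduct_mulVec, vecMul_transpose]
  simp only [sub_mulVec, neg_mulVec, dotProduct_sub, dotProduct_neg, dotProduct_add, add_dotProduct,
    mulVec_add, e3, e4, ← mulVec_mulVec]
  ring
end
end

section
/- Let S = [[A, B],[Bᵗ, C]] be a symmetric (m+n)×(m+n) complex matrix (A of size m×m, C of size n×n) with −Re S positive definite, and let B[S] : L²(ℝⁿ) → L²(ℝᵐ) be the associated Gauss operator. Suppose α⁺, α⁻ ∈ ℂᵐ and β⁺, β⁻ ∈ ℂⁿ satisfy α⁺ = −A α⁻ − B β⁻ and β⁺ = Bᵗ α⁻ + C β⁻. Then for every Schwartz function f on ℝⁿ, Σ_{j=1}^m (α⁺_j x_j (B[S]f)(x) + α⁻_j ∂(B[S]f)/∂x_j (x)) = B[S](y ↦ Σ_{k=1}^n (β⁺_k y_k f(y) + β⁻_k ∂f/∂y_k (y)))(x) for all x ∈ ℝᵐ. -/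
open Matrix MeasureTheory Real

noncomputable section

/-- The Gauss operator `B[S] : L²(ℝⁿ) → L²(ℝᵐ)`. -/
def gaussOp {m n : ℕ} (S : Matrix (Fin m ⊕ Fin n) (Fin m ⊕ Fin n) ℂ)
    (f : (Fin n → ℝ) → ℂ) (x : Fin m → ℝ) : ℂ :=
  (((2 * π) ^ (-(((m : ℝ) + n) / 4)) : ℝ) : ℂ) *
    ∫ y : Fin n → ℝ, Complex.exp ((1 / 2 : ℂ) * qf S x y) * f y

/-- The bilinear form of `S` as a continuous bilinear map. -/
def bilS {ι : Type*} [Fintype ι] (S : Matrix ι ι ℂ) : (ι → ℝ) →L[ℝ] (ι → ℝ) →L[ℝ] ℂ :=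
  LinearMap.toContinuousLinearMap
    ((LinearMap.toContinuousLinearMap (𝕜 := ℝ) (E := ι → ℝ) (F' := ℂ)).toLinearMap ∘ₗ
      (LinearMap.mk₂ ℝ (fun z w : ι → ℝ => dotProduct (cv w) (S.mulVec (cv z)))
        (by
          intro a b c
          have : cv (a + b) = cv a + cv b := by ext i; simp [cv]
          rw [this, mulVec_add, dotProduct_add])
        (by
          intro r a c
          have : cv (r • a) = (r : ℂ) • cv a := by ext i; simp [cv]
          rw [this, mulVec_smul, dotProduct_smul]; simp)
        (by
          intro a b c
          have : cv (b + c) = cv b + cv c := by ext i; simp [cv]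
          rw [this, add_dotProduct])
        (by
          intro r a c
          have : cv (r • c) = (r : ℂ) • cv c := by ext i; simp [cv]
          rw [this, smul_dotProduct]; simp)))

theorem bilS_apply {ι : Type*} [Fintype ι] (S : Matrix ι ι ℂ) (z w : ι → ℝ) :
    bilS S z w = dotProduct (cv w) (S.mulVec (cv z)) := rfl

theorem bilS_symm {ι : Type*} [Fintype ι] (S : Matrix ι ι ℂ) (hS : Sᵀ = S) (z w : ι → ℝ) :
    bilS S z w = bilS S w z := by
  rw [bilS_apply, bilS_apply, dotProduct_mulVec, ← mulVec_transpose, hS, dotProduct_comm]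

/-- The Gaussian kernel. -/
def expQ {ι : Type*} [Fintype ι] (S : Matrix ι ι ℂ) (z : ι → ℝ) : ℂ :=
  Complex.exp ((1 / 2 : ℂ) * bilS S z z)

theorem expQ_hasFDerivAt {ι : Type*} [Fintype ι] (S : Matrix ι ι ℂ) (hS : Sᵀ = S) (z : ι → ℝ) :
    HasFDerivAt (expQ S) (expQ S z • bilS S z) z := by
  have h1 : HasFDerivAt (fun z => bilS S z z) _ z :=
    (bilS S).hasFDerivAt.clm_apply (hasFDerivAt_id z)
  have h2 := (h1.const_mul (1 / 2 : ℂ)).cexp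
  refine h2.congr_fderiv ?_
  ext w
  simp [expQ, bilS_symm S hS w z]
  ring

theorem expQ_continuous {ι : Type*} [Fintype ι] (S : Matrix ι ι ℂ) : Continuous (expQ S) := by
  unfold expQ
  have : Continuous (fun z => bilS S z z) := (bilS S).continuous.clm_apply continuous_id
  fun_prop

theorem expQ_norm_le {ι : Type*} [Fintype ι] (S : Matrix ι ι ℂ)
    (hneg : (-(S.map Complex.re)).PosDef) (z : ι → ℝ) : ‖expQ S z‖ ≤ 1 := by
  have h := hneg.posSemidef.dotProduct_mulVec_nonneg z
  rw [expQ, Complex.norm_exp, Real.exp_le_one_iff]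
  have h2 : (bilS S z z).re = dotProduct z ((S.map Complex.re).mulVec z) := by
    simp [bilS_apply, dotProduct, mulVec, cv]
  have h3 : ((1 / 2 : ℂ) * bilS S z z).re = (1 / 2) * (bilS S z z).re := by
    have : (1 / 2 : ℂ) = ((1 / 2 : ℝ) : ℂ) := by norm_num
    rw [this, Complex.re_ofReal_mul]
  rw [h3, h2]
  simp only [neg_mulVec, dotProduct_neg, star_trivial] at h
  linarith

/-- First inclusion. -/
def inlS (m n : ℕ) : (Fin m → ℝ) →L[ℝ] (Fin m ⊕ Fin n → ℝ) :=
  LinearMap.toContinuousLinearMap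
    { toFun := fun x => Sum.elim x 0
      map_add' := by intro a b; ext i; cases i <;> simp
      map_smul' := by intro a b; ext i; cases i <;> simp }

/-- Second inclusion. -/
def inrS (m n : ℕ) : (Fin n → ℝ) →L[ℝ] (Fin m ⊕ Fin n → ℝ) :=
  LinearMap.toContinuousLinearMap
    { toFun := fun y => Sum.elim 0 y
      map_add' := by intro a b; ext i; cases i <;> simp
      map_smul' := by intro a b; ext i; cases i <;> simp }

theorem inlS_apply {m n : ℕ} (x : Fin m → ℝ) : inlS m n x = Sum.elim x (0 : Fin n → ℝ) := rfl
theorem inrS_apply {m n : ℕ} (y : Fin n → ℝ) : inrS m n y = Sum.elim (0 : Fin m → ℝ) y := rfl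

theorem elim_eq {m n : ℕ} (x : Fin m → ℝ) (y : Fin n → ℝ) :
    Sum.elim x y = inlS m n x + inrS m n y := by
  ext i; cases i <;> simp [inlS_apply, inrS_apply]

theorem kernel_eq {m n : ℕ} (S : Matrix (Fin m ⊕ Fin n) (Fin m ⊕ Fin n) ℂ)
    (x : Fin m → ℝ) (y : Fin n → ℝ) :
    Complex.exp ((1 / 2 : ℂ) * qf S x y) = expQ S (inlS m n x + inrS m n y) := by
  rw [← elim_eq]; rfl

theorem integrable_growth {n : ℕ} {V : Type*} [NormedAddCommGroup V] [NormedSpace ℝ V]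
    (g : SchwartzMap (Fin n → ℝ) ℂ) (h : (Fin n → ℝ) → V)
    (hc : Continuous h) (a b : ℝ) (hb : ∀ y, ‖h y‖ ≤ (a + b * ‖y‖) * ‖g y‖) :
    Integrable h := by
  have h0 : Integrable (fun y => (a + b * ‖y‖) * ‖g y‖) := by
    have := ((g.integrable_pow_mul volume 0).const_mul a).add
      ((g.integrable_pow_mul volume 1).const_mul b)
    refine this.congr (Filter.Eventually.of_forall fun y => ?_)
    simp; ring
  exact h0.mono' hc.aestronglyMeasurable (Filter.Eventually.of_forall hb)

section
variable {m n : ℕ} (S : Matrix (Fin m ⊕ Fin n) (Fin m ⊕ Fin n) ℂ)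

theorem bil_bound (x : Fin m → ℝ) (y : Fin n → ℝ) :
    ‖bilS S (inlS m n x + inrS m n y)‖ ≤
      ‖bilS S‖ * (‖inlS m n‖ * ‖x‖) + ‖bilS S‖ * ‖inrS m n‖ * ‖y‖ := by
  calc _ ≤ ‖bilS S‖ * ‖inlS m n x + inrS m n y‖ := (bilS S).le_opNorm _
    _ ≤ ‖bilS S‖ * (‖inlS m n‖ * ‖x‖ + ‖inrS m n‖ * ‖y‖) := by
      gcongr
      exact (norm_add_le _ _).trans
        (add_le_add ((inlS m n).le_opNorm _) ((inrS m n).le_opNorm _))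
    _ = _ := by ring

theorem ker_cont (x : Fin m → ℝ) :
    Continuous (fun y => expQ S (inlS m n x + inrS m n y)) :=
  (expQ_continuous S).comp (continuous_const.add (inrS m n).continuous)

theorem bil_cont (x : Fin m → ℝ) :
    Continuous (fun y => bilS S (inlS m n x + inrS m n y)) :=
  (bilS S).continuous.comp (continuous_const.add (inrS m n).continuous)

theorem integrable_ker (hneg : (-(S.map Complex.re)).PosDef) (g : SchwartzMap (Fin n → ℝ) ℂ)
    (x : Fin m → ℝ) :
    Integrable (fun y => expQ S (inlS m n x + inrS m n y) * g y) := by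
  refine integrable_growth g _ ((ker_cont S x).mul g.continuous) 1 0 fun y => ?_
  rw [norm_mul]
  have := expQ_norm_le S hneg (inlS m n x + inrS m n y)
  gcongr
  simpa using this

theorem integrable_ker_bil (hneg : (-(S.map Complex.re)).PosDef) (g : SchwartzMap (Fin n → ℝ) ℂ)
    (x : Fin m → ℝ) (w : Fin m ⊕ Fin n → ℝ) :
    Integrable (fun y => expQ S (inlS m n x + inrS m n y) *
      bilS S (inlS m n x + inrS m n y) w * g y) := by
  refine integrable_growth g _
    (((ker_cont S x).mul ((bil_cont S x).clm_apply continuous_const)).mul g.continuous)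
    (‖bilS S‖ * (‖inlS m n‖ * ‖x‖) * ‖w‖) (‖bilS S‖ * ‖inrS m n‖ * ‖w‖) fun y => ?_
  rw [norm_mul, norm_mul]
  have h1 := expQ_norm_le S hneg (inlS m n x + inrS m n y)
  have h2 := bil_bound S x y
  have h3 := (bilS S (inlS m n x + inrS m n y)).le_opNorm w
  gcongr
  calc _ ≤ 1 * (‖bilS S (inlS m n x + inrS m n y)‖ * ‖w‖) := by gcongr
    _ ≤ 1 * ((‖bilS S‖ * (‖inlS m n‖ * ‖x‖) + ‖bilS S‖ * ‖inrS m n‖ * ‖y‖) * ‖w‖) := by gcongr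
    _ = _ := by ring

theorem fderiv_integral (hS : Sᵀ = S) (hneg : (-(S.map Complex.re)).PosDef)
    (f : SchwartzMap (Fin n → ℝ) ℂ) (x v : Fin m → ℝ) :
    DifferentiableAt ℝ (fun x => ∫ y, expQ S (inlS m n x + inrS m n y) * f y) x ∧
    fderiv ℝ (fun x => ∫ y, expQ S (inlS m n x + inrS m n y) * f y) x v =
      ∫ y, expQ S (inlS m n x + inrS m n y) *
        bilS S (inlS m n x + inrS m n y) (inlS m n v) * f y := by
  let F' : (Fin m → ℝ) → (Fin n → ℝ) → (Fin m → ℝ) →L[ℝ] ℂ := fun x y =>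
    f y • (expQ S (inlS m n x + inrS m n y) •
      (bilS S (inlS m n x + inrS m n y)).comp (inlS m n))
  have hF'c : Continuous (F' x) :=
    f.continuous.smul ((ker_cont S x).smul ((bil_cont S x).clm_comp continuous_const))
  have hb : ∀ x' ∈ Metric.ball x 1, ∀ y, ‖F' x' y‖ ≤
      (‖bilS S‖ * (‖inlS m n‖ * (‖x‖ + 1)) * ‖inlS m n‖ +
        ‖bilS S‖ * ‖inrS m n‖ * ‖inlS m n‖ * ‖y‖) * ‖f y‖ := by
    intro x' hx' y
    have hx : ‖x'‖ ≤ ‖x‖ + 1 := by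
      have : ‖x' - x‖ < 1 := by simpa [dist_eq_norm] using hx'
      have := norm_le_norm_add_norm_sub' x' x
      linarith
    have h1 := expQ_norm_le S hneg (inlS m n x' + inrS m n y)
    have h2 := bil_bound S x' y
    have h3 := (bilS S (inlS m n x' + inrS m n y)).opNorm_comp_le (inlS m n)
    rw [norm_smul, norm_smul, mul_comm]
    gcongr
    calc _ ≤ 1 * (‖bilS S (inlS m n x' + inrS m n y)‖ * ‖inlS m n‖) := by gcongr
      _ ≤ 1 * ((‖bilS S‖ * (‖inlS m n‖ * (‖x‖ + 1)) + ‖bilS S‖ * ‖inrS m n‖ * ‖y‖)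
            * ‖inlS m n‖) := by
          gcongr
          exact h2.trans (by gcongr)
      _ = _ := by ring
  have hbi : Integrable (fun y => (‖bilS S‖ * (‖inlS m n‖ * (‖x‖ + 1)) * ‖inlS m n‖ +
        ‖bilS S‖ * ‖inrS m n‖ * ‖inlS m n‖ * ‖y‖) * ‖f y‖) := by
    refine integrable_growth f _ (by have := f.continuous; fun_prop)
      (‖bilS S‖ * (‖inlS m n‖ * (‖x‖ + 1)) * ‖inlS m n‖)
      (‖bilS S‖ * ‖inrS m n‖ * ‖inlS m n‖) fun y => ?_
    rw [Real.norm_of_nonneg (by positivity)]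
  have key := hasFDerivAt_integral_of_dominated_of_fderiv_le (𝕜 := ℝ) (μ := volume)
    (F := fun x y => expQ S (inlS m n x + inrS m n y) * f y) (F' := F') (x₀ := x)
    (Metric.ball_mem_nhds x one_pos)
    (Filter.Eventually.of_forall fun x' =>
      ((ker_cont S x').mul f.continuous).aestronglyMeasurable)
    (integrable_ker S hneg f x) hF'c.aestronglyMeasurable
    (Filter.Eventually.of_forall fun y x' hx' => hb x' hx' y) hbi
    (Filter.Eventually.of_forall fun y x' hx' => by
      have h1 : HasFDerivAt (fun x => inlS m n x + inrS m n y) (inlS m n) x' :=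
        (inlS m n).hasFDerivAt.add_const _
      have h2 := ((expQ_hasFDerivAt S hS (inlS m n x' + inrS m n y)).comp x' h1).mul_const (f y)
      exact h2.congr_fderiv (by ext; simp [F']))
  refine ⟨key.differentiableAt, ?_⟩
  have hFi : Integrable (F' x) := hbi.mono' hF'c.aestronglyMeasurable
    (Filter.Eventually.of_forall fun y => hb x (Metric.mem_ball_self one_pos) y)
  rw [key.fderiv, ContinuousLinearMap.integral_apply hFi]
  congr 1
  ext y
  simp [F']; ring

theorem by_parts (hS : Sᵀ = S) (hneg : (-(S.map Complex.re)).PosDef)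
    (f : SchwartzMap (Fin n → ℝ) ℂ) (x : Fin m → ℝ) (v : Fin n → ℝ) :
    Integrable (fun y => expQ S (inlS m n x + inrS m n y) * fderiv ℝ f y v) ∧
    ∫ y, expQ S (inlS m n x + inrS m n y) * fderiv ℝ f y v =
      - ∫ y, expQ S (inlS m n x + inrS m n y) *
        bilS S (inlS m n x + inrS m n y) (inrS m n v) * f y := by
  have hd : ∀ y, HasFDerivAt (fun y => expQ S (inlS m n x + inrS m n y))
      ((expQ S (inlS m n x + inrS m n y) • bilS S (inlS m n x + inrS m n y)).comp
        (inrS m n)) y := by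
    intro y
    have h1 : HasFDerivAt (fun y => inlS m n x + inrS m n y) (inrS m n) y :=
      (inrS m n).hasFDerivAt.const_add _
    exact (expQ_hasFDerivAt S hS (inlS m n x + inrS m n y)).comp y h1
  have hfd : ∀ y, fderiv ℝ (fun y => expQ S (inlS m n x + inrS m n y)) y v =
      expQ S (inlS m n x + inrS m n y) * bilS S (inlS m n x + inrS m n y) (inrS m n v) := by
    intro y; rw [(hd y).fderiv]; simp; ring
  have hi : Integrable (fun y => expQ S (inlS m n x + inrS m n y) * fderiv ℝ f y v) :=
    integrable_ker S hneg (LineDeriv.lineDerivOp v f) x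
  refine ⟨hi, ?_⟩
  rw [integral_mul_fderiv_eq_neg_fderiv_mul_of_integrable (μ := volume) ?_ hi
    (integrable_ker S hneg f x) (fun y _ => (hd y).differentiableAt)
    (fun y _ => f.differentiableAt)]
  · simp_rw [hfd]
  · simp_rw [hfd]
    exact integrable_ker_bil S hneg f x _

end

/-- the Gauss operator `B[S]` intertwines the Heisenberg operators
`Â(α)` and `Â(β)` whenever `α⁺ = −Aα⁻ − Bβ⁻` and `β⁺ = Bᵗα⁻ + Cβ⁻`. -/
theorem gaussOp_intertwines_heisenberg (m n : ℕ)
    (A : Matrix (Fin m) (Fin m) ℂ) (B : Matrix (Fin m) (Fin n) ℂ)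
    (C : Matrix (Fin n) (Fin n) ℂ)
    (hA : Aᵀ = A) (hC : Cᵀ = C)
    (S : Matrix (Fin m ⊕ Fin n) (Fin m ⊕ Fin n) ℂ)
    (hS : S = Matrix.fromBlocks A B Bᵀ C)
    (hneg : (-(S.map Complex.re)).PosDef)
    (αp αm : Fin m → ℂ) (βp βm : Fin n → ℂ)
    (hα : αp = -(A.mulVec αm) - B.mulVec βm)
    (hβ : βp = Bᵀ.mulVec αm + C.mulVec βm)
    (f : SchwartzMap (Fin n → ℝ) ℂ) :
    ∀ x : Fin m → ℝ,
      (∑ j, (αp j * (x j : ℂ) * gaussOp S (⇑f) x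
        + αm j * fderiv ℝ (gaussOp S (⇑f)) x (Pi.single j 1)))
      = gaussOp S
          (fun y => ∑ k, (βp k * (y k : ℂ) * f y + βm k * fderiv ℝ (⇑f) y (Pi.single k 1)))
          x := by
  intro x
  have hSs : Sᵀ = S := by rw [hS, fromBlocks_transpose, hA, hC, transpose_transpose]
  set K : (Fin n → ℝ) → ℂ := fun y => expQ S (inlS m n x + inrS m n y) with hK
  set c : ℂ := (((2 * π) ^ (-(((m : ℝ) + n) / 4)) : ℝ) : ℂ) with hc
  have hg : ∀ g : (Fin n → ℝ) → ℂ, gaussOp S g =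
      fun x => c * ∫ y, expQ S (inlS m n x + inrS m n y) * g y := by
    intro g; ext x; simp only [gaussOp, kernel_eq, hc]
  -- derivatives of the exponent
  have hL : ∀ y j, bilS S (inlS m n x + inrS m n y) (inlS m n (Pi.single j 1)) =
      (A.mulVec (cv x)) j + (B.mulVec (cv y)) j := by
    intro y j
    rw [← elim_eq, bilS_apply, inlS_apply, hS]
    simp [dotProduct, mulVec, cv, Pi.single_apply, apply_ite Complex.ofReal]
  have hR : ∀ y k, bilS S (inlS m n x + inrS m n y) (inrS m n (Pi.single k 1)) =
      (Bᵀ.mulVec (cv x)) k + (C.mulVec (cv y)) k := by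
    intro y k
    rw [← elim_eq, bilS_apply, inrS_apply, hS]
    simp [dotProduct, mulVec, cv, Pi.single_apply, apply_ite Complex.ofReal]
  have hIf : Integrable (fun y => K y * f y) := integrable_ker S hneg f x
  have hIL : ∀ w, Integrable (fun y => K y *
      bilS S (inlS m n x + inrS m n y) w * f y) := integrable_ker_bil S hneg f x
  have hIy : ∀ k, Integrable (fun y : Fin n → ℝ => K y * ((y k : ℂ) * f y)) := by
    intro k
    refine integrable_growth f _ ((ker_cont S x).mul (Continuous.mul (by fun_prop) f.continuous))
      0 1 fun y => ?_
    rw [norm_mul, norm_mul]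
    have h1 := expQ_norm_le S hneg (inlS m n x + inrS m n y)
    have h2 : ‖(y k : ℂ)‖ ≤ ‖y‖ := by simpa using norm_le_pi_norm y k
    calc _ ≤ 1 * (‖y‖ * ‖f y‖) := by gcongr
      _ = _ := by ring
  have hder : ∀ j, fderiv ℝ (gaussOp S f) x (Pi.single j 1) =
      c * ∫ y, K y * bilS S (inlS m n x + inrS m n y) (inlS m n (Pi.single j 1)) * f y := by
    intro j
    obtain ⟨h1, h2⟩ := fderiv_integral S hSs hneg f x (Pi.single j 1)
    rw [hg, fderiv_const_mul h1, _root_.smul_apply, h2]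
    simp [K]
  have hLHS : (∑ j, (αp j * (x j : ℂ) * gaussOp S (⇑f) x
        + αm j * fderiv ℝ (gaussOp S (⇑f)) x (Pi.single j 1))) =
      c * ∫ y, ∑ j, (αp j * (x j : ℂ) * (K y * f y) + αm j *
        (K y * bilS S (inlS m n x + inrS m n y) (inlS m n (Pi.single j 1)) * f y)) := by
    rw [integral_finsetSum]
    swap
    · intro j _
      exact (hIf.const_mul _).add ((hIL _).const_mul _)
    rw [Finset.mul_sum]
    refine Finset.sum_congr rfl fun j _ => ?_
    rw [integral_add (hIf.const_mul _) ((hIL _).const_mul _), integral_const_mul,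
      integral_const_mul, hder, hg]
    simp only [hK]
    ring
  have hRHS : gaussOp S (fun y => ∑ k, (βp k * (y k : ℂ) * f y +
        βm k * fderiv ℝ (⇑f) y (Pi.single k 1))) x =
      c * ∫ y, ∑ k, (βp k * (K y * ((y k : ℂ) * f y)) - βm k *
        (K y * bilS S (inlS m n x + inrS m n y) (inrS m n (Pi.single k 1)) * f y)) := by
    rw [hg]
    simp only
    congr 1
    have hP := fun k : Fin n => by_parts S hSs hneg f x (Pi.single k 1)
    have e1 : ∀ y, expQ S (inlS m n x + inrS m n y) * ∑ k, (βp k * (y k : ℂ) * f y +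
        βm k * fderiv ℝ (⇑f) y (Pi.single k 1)) = ∑ k, (βp k * (K y * ((y k : ℂ) * f y)) +
        βm k * (expQ S (inlS m n x + inrS m n y) * fderiv ℝ (⇑f) y (Pi.single k 1))) := by
      intro y
      rw [Finset.mul_sum]
      refine Finset.sum_congr rfl fun k _ => ?_
      simp only [hK]; ring
    simp_rw [e1]
    rw [integral_finsetSum]
    swap
    · intro k _
      exact ((hIy k).const_mul _).add ((hP k).1.const_mul _)
    rw [integral_finsetSum]
    swap
    · intro k _
      exact ((hIy k).const_mul _).sub ((hIL _).const_mul _)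
    refine Finset.sum_congr rfl fun k _ => ?_
    rw [integral_add ((hIy k).const_mul _) ((hP k).1.const_mul _),
      integral_sub ((hIy k).const_mul _) ((hIL _).const_mul _), integral_const_mul,
      integral_const_mul, integral_const_mul, (hP k).2]
    ring
  rw [hLHS, hRHS]
  congr 2
  ext y
  simp only [hL, hR]
  have l : ∑ j, (αp j * (x j : ℂ) * (K y * f y) + αm j *
        (K y * ((A.mulVec (cv x)) j + (B.mulVec (cv y)) j) * f y)) =
      (αp ⬝ᵥ cv x + αm ⬝ᵥ A.mulVec (cv x) + αm ⬝ᵥ B.mulVec (cv y)) * (K y * f y) := by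
    simp only [dotProduct, ← Finset.sum_add_distrib, Finset.sum_mul]
    refine Finset.sum_congr rfl fun k _ => ?_
    simp only [cv]; ring
  have r : ∑ k, (βp k * (K y * ((y k : ℂ) * f y)) - βm k *
        (K y * ((Bᵀ.mulVec (cv x)) k + (C.mulVec (cv y)) k) * f y)) =
      (βp ⬝ᵥ cv y - βm ⬝ᵥ Bᵀ.mulVec (cv x) - βm ⬝ᵥ C.mulVec (cv y)) * (K y * f y) := by
    simp only [dotProduct, ← Finset.sum_sub_distrib, Finset.sum_mul]
    refine Finset.sum_congr rfl fun k _ => ?_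
    simp only [cv]; ring
  rw [l, r]
  congr 1
  have a1 : αm ⬝ᵥ A.mulVec (cv x) = A.mulVec αm ⬝ᵥ cv x := by
    rw [dotProduct_mulVec, ← mulVec_transpose, hA]
  have a2 : αm ⬝ᵥ B.mulVec (cv y) = Bᵀ.mulVec αm ⬝ᵥ cv y := by
    rw [dotProduct_mulVec, ← mulVec_transpose]
  have a3 : βm ⬝ᵥ Bᵀ.mulVec (cv x) = B.mulVec βm ⬝ᵥ cv x := by
    rw [dotProduct_mulVec, ← mulVec_transpose, transpose_transpose]
  have a4 : βm ⬝ᵥ C.mulVec (cv y) = C.mulVec βm ⬝ᵥ cv y := by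
    rw [dotProduct_mulVec, ← mulVec_transpose, hC]
  rw [a1, a2, a3, a4, hα, hβ, sub_dotProduct, neg_dotProduct, add_dotProduct]
  ring
end
end

section
/- Let m, n, q be nonnegative integers. Let S₁ = [[A, B],[Bᵗ, C]] be a symmetric (m+q)×(m+q) complex matrix (A of size m×m, C of size q×q) with negative definite real part, and S₂ = [[K, L],[Lᵗ, M]] a symmetric (q+n)×(q+n) complex matrix (K of size q×q, M of size n×n) with negative definite real part. Set S₃ = [[A − B(C+K)⁻¹Bᵗ, −B(C+K)⁻¹L],[−Lᵗ(C+K)⁻¹Bᵗ, M − Lᵗ(C+K)⁻¹L]]. Then C + K is invertible, S₃ is symmetric of size (m+n)×(m+n) with negative definite real part, and there exists λ ∈ ℂ with λ² = det(−C−K)⁻¹ such that for all x, ξ ∈ ℝᵐ and y, η ∈ ℝⁿ: ∫_{[0,2π]^{2q}} K_{q,m}[S₁](x, ξ; s, ζ) · K_{n,q}[S₂](s, ζ; y, η) ds dζ = (2π)^{3q/2} λ · K_{n,m}[S₃](x, ξ; y, η). Consequently the integral operators with theta-kernels compose as Q_{q,m}[S₁] ∘ Q_{n,q}[S₂] = λ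 · Q_{n,m}[S₃]. -/
open Matrix MeasureTheory Real

noncomputable section

/-- The theta-kernel
`K_{n,m}[S](x,ξ;y,η) = Σ_{k∈ℤᵐ} Σ_{l∈ℤⁿ} exp{b(x+2πk, y+2πl)} e^{i k·ξ} e^{−i l·η}`
where `b(x,y) = ½ (xᵗ,yᵗ) S (x,y)ᵗ`. -/
def thetaKernel {m n : ℕ} (S : Matrix (Fin m ⊕ Fin n) (Fin m ⊕ Fin n) ℂ)
    (x ξ : Fin m → ℝ) (y η : Fin n → ℝ) : ℂ :=
  ∑' kl : (Fin m → ℤ) × (Fin n → ℤ),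
    Complex.exp ((1 / 2 : ℂ) *
        qf S (fun i => x i + 2 * π * kl.1 i) (fun i => y i + 2 * π * kl.2 i))
      * Complex.exp (Complex.I * ∑ i, (kl.1 i : ℂ) * (ξ i : ℂ))
      * Complex.exp (-Complex.I * ∑ i, (kl.2 i : ℂ) * (η i : ℂ))

/-- The integral operator `Q_{n,m}[S]` with kernel `(2π)^{−3(n+m)/4} K_{n,m}[S]`,
integrating over `(y, η) ∈ [0,2π]^{2n}`. -/
def thetaOp {m n : ℕ} (S : Matrix (Fin m ⊕ Fin n) (Fin m ⊕ Fin n) ℂ)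
    (g : (Fin n → ℝ) → (Fin n → ℝ) → ℂ) (x ξ : Fin m → ℝ) : ℂ :=
  (((2 * π) ^ (-(3 * ((n : ℝ) + m) / 4)) : ℝ) : ℂ) *
    ∫ p in Set.Icc ((0, 0) : (Fin n → ℝ) × (Fin n → ℝ))
        ((fun _ => 2 * π), (fun _ => 2 * π)),
      thetaKernel S x ξ p.1 p.2 * g p.1 p.2

lemma spec_real {ι : Type*} [Fintype ι] [DecidableEq ι] (A : Matrix ι ι ℝ) (hA : Aᵀ = A) :
    ∃ (U : Matrix ι ι ℝ) (d : ι → ℝ), Uᵀ * U = 1 ∧ Uᵀ * A * U = diagonal d := by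
  have hH : A.IsHermitian := by
    rw [Matrix.IsHermitian, conjTranspose_eq_transpose_of_trivial, hA]
  refine ⟨hH.eigenvectorUnitary, hH.eigenvalues, ?_, ?_⟩
  · have := Unitary.coe_star_mul_self hH.eigenvectorUnitary
    rwa [star_eq_conjTranspose, conjTranspose_eq_transpose_of_trivial] at this
  · have := hH.conjStarAlgAut_star_eigenvectorUnitary
    rw [Unitary.conjStarAlgAut_apply] at this
    simpa [star_eq_conjTranspose, conjTranspose_eq_transpose_of_trivial, Function.comp_def] using this

lemma diag_quad {ι : Type*} [Fintype ι] [DecidableEq ι] {R : Type*} [CommRing R]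
    (P U : Matrix ι ι R) (d t : ι → R)
    (h : Uᵀ * P * U = diagonal d) :
    (U *ᵥ t) ⬝ᵥ (P *ᵥ (U *ᵥ t)) = ∑ i, d i * t i ^ 2 := by
  have : (U *ᵥ t) ⬝ᵥ (P *ᵥ (U *ᵥ t)) = t ⬝ᵥ ((Uᵀ * P * U) *ᵥ t) := by
    rw [← mulVec_mulVec, ← mulVec_mulVec, dotProduct_mulVec t, vecMul_transpose]
  rw [this, h]
  simp only [dotProduct, mulVec_diagonal]
  exact Finset.sum_congr rfl fun i _ => by ring

lemma posdef_bound {ι : Type*} [Fintype ι] [DecidableEq ι] (P : Matrix ι ι ℝ) (hP : P.PosDef) :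
    ∃ c > 0, ∀ x : ι → ℝ, c * ∑ i, x i ^ 2 ≤ x ⬝ᵥ (P *ᵥ x) := by
  have hs : Pᵀ = P := by
    have := hP.1
    rwa [Matrix.IsHermitian, conjTranspose_eq_transpose_of_trivial] at this
  obtain ⟨U, d, hU, hd⟩ := spec_real P hs
  have hU' : U * Uᵀ = 1 := mul_eq_one_comm.mp hU
  have hdpos : ∀ i, 0 < d i := by
    intro i
    have h1 := diag_quad P U d (Pi.single i 1) hd
    have h2 : (U *ᵥ (Pi.single i 1)) ≠ 0 := by
      intro h
      have : Uᵀ *ᵥ (U *ᵥ (Pi.single i (1:ℝ))) = 0 := by rw [h, mulVec_zero]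
      rw [mulVec_mulVec, hU, one_mulVec] at this
      have := congrFun this i
      simp at this
    have h3 := hP.dotProduct_mulVec_pos h2
    rw [star_trivial, h1] at h3
    simpa [Pi.single_apply] using h3
  obtain ⟨c, hc, hcd⟩ : ∃ c > 0, ∀ i, c ≤ d i := by
    rcases isEmpty_or_nonempty ι with h | h
    · exact ⟨1, one_pos, fun i => h.elim i⟩
    · obtain ⟨i, hi⟩ := Finite.exists_min d
      exact ⟨d i, hdpos i, hi⟩
  refine ⟨c, hc, fun x => ?_⟩
  have hx : x = U *ᵥ (Uᵀ *ᵥ x) := by rw [mulVec_mulVec, hU', one_mulVec]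
  have h1 := diag_quad P U d (Uᵀ *ᵥ x) hd
  have h2 := diag_quad 1 U (fun _ => 1) (Uᵀ *ᵥ x) (by rw [mul_one, hU]; exact diagonal_one.symm)
  rw [← hx] at h1 h2
  rw [one_mulVec] at h2
  have h3 : ∑ i, x i ^ 2 = x ⬝ᵥ x := by simp [dotProduct, sq]
  rw [h3, h1, h2, Finset.mul_sum]
  refine Finset.sum_le_sum fun i _ => ?_
  have := hcd i
  have := sq_nonneg ((Uᵀ *ᵥ x) i)
  nlinarith

lemma simul_diag_s16 {ι : Type*} [Fintype ι] [DecidableEq ι] (P R : Matrix ι ι ℝ) (hP : P.PosDef)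
    (hR : Rᵀ = R) : ∃ (G : Matrix ι ι ℝ) (d : ι → ℝ), Gᵀ * P * G = 1 ∧ Gᵀ * R * G = diagonal d := by
  have hs : Pᵀ = P := by
    have := hP.1
    rwa [Matrix.IsHermitian, conjTranspose_eq_transpose_of_trivial] at this
  obtain ⟨U, d, hU, hd⟩ := spec_real P hs
  have hdpos : ∀ i, 0 < d i := by
    intro i
    have h1 := diag_quad P U d (Pi.single i 1) hd
    have h2 : (U *ᵥ (Pi.single i 1)) ≠ 0 := by
      intro h
      have : Uᵀ *ᵥ (U *ᵥ (Pi.single i (1:ℝ))) = 0 := by rw [h, mulVec_zero]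
      rw [mulVec_mulVec, hU, one_mulVec] at this
      have := congrFun this i
      simp at this
    have h3 := hP.dotProduct_mulVec_pos h2
    rw [star_trivial, h1] at h3
    simpa [Pi.single_apply] using h3
  set E : Matrix ι ι ℝ := diagonal (fun i => (√(d i))⁻¹) with hE
  have hEd : E * diagonal d * E = 1 := by
    rw [hE, diagonal_mul_diagonal, diagonal_mul_diagonal, ← diagonal_one]
    congr 1
    ext i
    have := Real.sq_sqrt (hdpos i).le
    have h' := Real.sqrt_pos.mpr (hdpos i)
    field_simp
    linarith
  have hEt : Eᵀ = E := diagonal_transpose _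
  obtain ⟨V, e, hV, he⟩ := spec_real ((U * E)ᵀ * R * (U * E)) (by
    simp only [transpose_mul, transpose_transpose, hR, Matrix.mul_assoc])
  refine ⟨U * E * V, e, ?_, ?_⟩
  · calc (U * E * V)ᵀ * P * (U * E * V) = Vᵀ * (Eᵀ * (Uᵀ * P * U) * E) * V := by
          simp only [transpose_mul, Matrix.mul_assoc]
      _ = 1 := by rw [hEt, hd, hEd, Matrix.mul_one, hV]
  · rw [← he]
    simp only [transpose_mul, Matrix.mul_assoc]
lemma cv_mulVec {ι : Type*} [Fintype ι] (G : Matrix ι ι ℝ) (t : ι → ℝ) :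
    cv (G *ᵥ t) = (G.map Complex.ofReal) *ᵥ cv t := by
  ext i
  simp [cv, mulVec, dotProduct]

lemma cont_cv {ι : Type*} : Continuous (cv : (ι → ℝ) → (ι → ℂ)) := by
  unfold cv; fun_prop

lemma gauss (q : ℕ) (N : Matrix (Fin q) (Fin q) ℂ) (hsym : Nᵀ = N)
    (hpos : (N.map Complex.re).PosDef) :
    ∃ lam : ℂ, lam ^ 2 = N.det⁻¹ ∧ ∀ v : Fin q → ℂ,
      ∫ s : Fin q → ℝ, Complex.exp (-(1/2) * (cv s ⬝ᵥ (N *ᵥ cv s)) + v ⬝ᵥ cv s)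
        = (((2 * π) ^ ((q : ℝ) / 2) : ℝ) : ℂ) * lam * Complex.exp (1/2 * (v ⬝ᵥ (N⁻¹ *ᵥ v))) := by
  obtain ⟨G, d, h1, h2⟩ := simul_diag_s16 (N.map Complex.re) (N.map Complex.im) hpos (by
    conv_rhs => rw [← hsym]
    rfl)
  set H : Matrix (Fin q) (Fin q) ℂ := G.map Complex.ofReal with hH
  set e : Fin q → ℂ := fun i => 1 + Complex.I * d i with he
  have hdet : G.det ≠ 0 := by
    intro h
    have := congrArg Matrix.det h1
    simp [h] at this
  have hdetH : H.det = (G.det : ℂ) := by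
    have := (RingHom.map_det Complex.ofRealHom G)
    simp only [RingHom.mapMatrix_apply] at this
    exact this.symm
  have hN : N = (N.map Complex.re).map Complex.ofReal
      + Complex.I • (N.map Complex.im).map Complex.ofReal := by
    ext i j
    simp [mul_comm Complex.I, Complex.re_add_im]
  have hD : Hᵀ * N * H = diagonal e := by
    have e1 : Hᵀ * (N.map Complex.re).map Complex.ofReal * H = 1 := by
      have := congrArg (fun X => X.map Complex.ofRealHom) h1
      simp only [Matrix.map_mul, transpose_map] at this
      simp only [Matrix.map_one _ (map_zero _) (map_one _)] at this
      exact this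
    have e2 : Hᵀ * (N.map Complex.im).map Complex.ofReal * H
        = diagonal (fun i => (d i : ℂ)) := by
      have := congrArg (fun X => X.map Complex.ofRealHom) h2
      simp only [Matrix.map_mul, transpose_map] at this
      simp only [diagonal_map (map_zero _)] at this
      exact this
    rw [hN, mul_add, add_mul, Matrix.mul_smul, Matrix.smul_mul, e1, e2, he, ← diagonal_one,
      ← diagonal_smul, diagonal_add]
    rfl
  have hene : ∀ i, e i ≠ 0 := by
    intro i h
    have := congrArg Complex.re h
    simp [he] at this
  have hprod : H.det ^ 2 * N.det = ∏ i, e i := by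
    have := congrArg Matrix.det hD
    rw [det_mul, det_mul, det_transpose, det_diagonal] at this
    rw [← this]; ring
  have hNdet : N.det ≠ 0 := by
    intro h
    rw [h, mul_zero] at hprod
    exact (Finset.prod_ne_zero_iff.mpr fun i _ => hene i) hprod.symm
  have hHdet : H.det ≠ 0 := by rw [hdetH]; exact_mod_cast hdet
  have hNinv : N⁻¹ = H * diagonal (fun i => (e i)⁻¹) * Hᵀ := by
    apply inv_eq_right_inv
    have hHu : IsUnit H.det := isUnit_iff_ne_zero.mpr hHdet
    have hHtu : IsUnit Hᵀ.det := by rwa [det_transpose]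
    have k1 : N * H = Hᵀ⁻¹ * diagonal e := by
      rw [← hD, Matrix.mul_assoc Hᵀ, nonsing_inv_mul_cancel_left _ _ hHtu]
    rw [← Matrix.mul_assoc, ← Matrix.mul_assoc, k1, Matrix.mul_assoc Hᵀ⁻¹, diagonal_mul_diagonal]
    simp only [mul_inv_cancel₀ (hene _), diagonal_one, mul_one]
    exact nonsing_inv_mul _ hHtu
  set Λ : ℂ := ((|G.det| : ℝ) : ℂ) * ∏ i, ((2 * π : ℂ) / e i) ^ (1/2 : ℂ) with hΛ
  have h2pi : (2 * π : ℂ) ≠ 0 := by exact_mod_cast (by positivity : (2 * π : ℝ) ≠ 0)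
  set c : ℂ := (((2 * π) ^ ((q : ℝ) / 2) : ℝ) : ℂ) with hc
  have hc2 : c ^ 2 = (2 * π : ℂ) ^ q := by
    have : (((2 * π) ^ ((q : ℝ) / 2)) ^ 2 : ℝ) = (2 * π) ^ q := by
      rw [← Real.rpow_natCast, ← Real.rpow_mul (by positivity), ← Real.rpow_natCast]
      congr 1
      push_cast; ring
    rw [hc]
    exact_mod_cast this
  have hcne : c ≠ 0 := by
    intro h
    rw [h] at hc2
    have := pow_ne_zero q h2pi
    rw [← hc2] at this
    simp at this
  have hΛ2 : Λ ^ 2 = c ^ 2 * N.det⁻¹ := by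
    rw [hΛ, mul_pow, ← Finset.prod_pow]
    have : ∀ i, (((2 * π : ℂ) / e i) ^ (1/2 : ℂ)) ^ 2 = (2 * π : ℂ) / e i := by
      intro i
      simp
    simp only [this, Finset.prod_div_distrib, ← hprod, hc2, Finset.prod_const, Finset.card_univ,
      Fintype.card_fin, hdetH]
    have h' : ((|G.det| : ℝ) : ℂ) ^ 2 = (G.det : ℂ) ^ 2 := by exact_mod_cast sq_abs G.det
    rw [h']
    have : (G.det : ℂ) ≠ 0 := by exact_mod_cast hdet
    field_simp
  refine ⟨c⁻¹ * Λ, ?_, fun v => ?_⟩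
  · rw [mul_pow, hΛ2]; field_simp
  rw [mul_inv_cancel_left₀ hcne]
  set f : (Fin q → ℝ) → ℂ :=
    fun s => Complex.exp (-(1/2) * (cv s ⬝ᵥ (N *ᵥ cv s)) + v ⬝ᵥ cv s) with hf
  have hfc : Continuous f := by
    have := @cont_cv (Fin q)
    rw [hf]
    refine Complex.continuous_exp.comp ((continuous_const.mul ?_).add ?_)
    · exact this.dotProduct (continuous_const.matrix_mulVec this)
    · exact continuous_const.dotProduct this
  have hmap := Real.map_matrix_volume_pi_eq_smul_volume_pi hdet
  have hchange : ∫ t, f (G *ᵥ t) = ((|G.det| : ℝ) : ℂ)⁻¹ * ∫ s, f s := by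
    have k := integral_map (μ := volume) (φ := toLin' G) (f := f)
      (by exact (LinearMap.continuous_of_finiteDimensional _).aemeasurable)
      hfc.aestronglyMeasurable
    rw [hmap, integral_smul_measure, ENNReal.toReal_ofReal (abs_nonneg _)] at k
    simp only [toLin'_apply] at k
    rw [← k, Complex.real_smul, abs_inv]
    push_cast
    rfl
  have hfs : ∀ t, f (G *ᵥ t) = ∏ i, Complex.exp (-(e i / 2) * (t i : ℂ) ^ 2 + (Hᵀ *ᵥ v) i * t i + 0) := by
    intro t
    rw [← Complex.exp_sum, hf]
    simp only [cv_mulVec]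
    rw [← hH, diag_quad N H e (cv t) hD, dotProduct_mulVec v, ← mulVec_transpose, dotProduct,
      Finset.mul_sum, ← Finset.sum_add_distrib]
    congr 1
    refine Finset.sum_congr rfl fun i _ => ?_
    simp only [cv]; ring
  have hG : ∫ t, f (G *ᵥ t) = (∏ i, ((2 * π : ℂ) / e i) ^ (1/2 : ℂ)) *
      Complex.exp (1/2 * (v ⬝ᵥ (N⁻¹ *ᵥ v))) := by
    simp only [hfs]
    rw [integral_fintype_prod_volume_eq_prod
      (f := fun i (x : ℝ) => Complex.exp (-(e i / 2) * (x : ℂ) ^ 2 + (Hᵀ *ᵥ v) i * x + 0))]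
    have : ∀ i, ∫ x : ℝ, Complex.exp (-(e i / 2) * (x : ℂ) ^ 2 + (Hᵀ *ᵥ v) i * x + 0)
        = ((2 * π : ℂ) / e i) ^ (1/2 : ℂ) * Complex.exp (1/2 * ((e i)⁻¹ * (Hᵀ *ᵥ v) i ^ 2)) := by
      intro i
      rw [integral_cexp_quadratic (by simp [he])]
      congr 2
      · field_simp [hene i]
      · field_simp [hene i]; ring
    simp only [this]
    rw [Finset.prod_mul_distrib, ← Complex.exp_sum, ← Finset.mul_sum, hNinv]
    congr 3
    rw [← mulVec_mulVec, ← mulVec_mulVec, dotProduct_mulVec v, ← mulVec_transpose, dotProduct]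
    refine Finset.sum_congr rfl fun i _ => ?_
    rw [mulVec_diagonal]; ring
  have habs : ((|G.det| : ℝ) : ℂ) ≠ 0 := by exact_mod_cast abs_ne_zero.mpr hdet
  rw [hchange] at hG
  rw [hΛ, mul_assoc, ← hG, mul_inv_cancel_left₀ habs]

lemma re_cv {ι : Type*} [Fintype ι] (S : Matrix ι ι ℂ) (x : ι → ℝ) :
    (cv x ⬝ᵥ (S *ᵥ cv x)).re = x ⬝ᵥ (S.map Complex.re *ᵥ x) := by
  simp [cv, dotProduct, mulVec]

lemma re_herm {ι : Type*} [Fintype ι] (S : Matrix ι ι ℂ) (hS : Sᵀ = S) (w : ι → ℂ) :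
    (star w ⬝ᵥ (S *ᵥ w)).re = (fun i => (w i).re) ⬝ᵥ (S.map Complex.re *ᵥ (fun i => (w i).re))
      + (fun i => (w i).im) ⬝ᵥ (S.map Complex.re *ᵥ (fun i => (w i).im)) := by
  have hs : ∀ i j, S i j = S j i := fun i j => by
    conv_lhs => rw [← hS]
    rfl
  have key : ∑ i, ∑ j, (S i j).im * ((w i).re * (w j).im)
      = ∑ i, ∑ j, (S i j).im * ((w i).im * (w j).re) := by
    rw [Finset.sum_comm]
    refine Finset.sum_congr rfl fun i _ => Finset.sum_congr rfl fun j _ => ?_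
    rw [hs j i]; ring
  have : (star w ⬝ᵥ (S *ᵥ w)).re - ((fun i => (w i).re) ⬝ᵥ (S.map Complex.re *ᵥ (fun i => (w i).re))
      + (fun i => (w i).im) ⬝ᵥ (S.map Complex.re *ᵥ (fun i => (w i).im)))
      = ∑ i, ∑ j, (S i j).im * ((w i).im * (w j).re)
        - ∑ i, ∑ j, (S i j).im * ((w i).re * (w j).im) := by
    simp only [dotProduct, mulVec, Complex.re_sum, Finset.mul_sum, ← Finset.sum_add_distrib,
      ← Finset.sum_sub_distrib, map_apply]
    refine Finset.sum_congr rfl fun i _ => Finset.sum_congr rfl fun j _ => ?_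
    simp [Complex.mul_re, Complex.mul_im]
    ring
  rw [key, sub_self] at this
  linarith

lemma herm_nonpos {ι : Type*} [Fintype ι] (S : Matrix ι ι ℂ) (hS : Sᵀ = S)
    (hneg : (-(S.map Complex.re)).PosDef) (w : ι → ℂ) :
    (star w ⬝ᵥ (S *ᵥ w)).re ≤ 0 := by
  rw [re_herm S hS]
  have h1 := hneg.posSemidef.dotProduct_mulVec_nonneg (fun i => (w i).re)
  have h2 := hneg.posSemidef.dotProduct_mulVec_nonneg (fun i => (w i).im)
  simp only [star_trivial, neg_mulVec, dotProduct_neg] at h1 h2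
  linarith

lemma herm_neg {ι : Type*} [Fintype ι] (S : Matrix ι ι ℂ) (hS : Sᵀ = S)
    (hneg : (-(S.map Complex.re)).PosDef) (w : ι → ℂ) (hw : w ≠ 0) :
    (star w ⬝ᵥ (S *ᵥ w)).re < 0 := by
  rw [re_herm S hS]
  have h1 := hneg.posSemidef.dotProduct_mulVec_nonneg (fun i => (w i).re)
  have h2 := hneg.posSemidef.dotProduct_mulVec_nonneg (fun i => (w i).im)
  simp only [star_trivial, neg_mulVec, dotProduct_neg] at h1 h2
  by_cases h : (fun i => (w i).re) = 0
  · have h' : (fun i => (w i).im) ≠ 0 := by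
      intro h'
      apply hw
      ext i
      exact Complex.ext (congrFun h i) (congrFun h' i)
    have := hneg.dotProduct_mulVec_pos h'
    simp only [star_trivial, neg_mulVec, dotProduct_neg] at this
    linarith
  · have := hneg.dotProduct_mulVec_pos h
    simp only [star_trivial, neg_mulVec, dotProduct_neg] at this
    linarith

lemma form_blocks {m n : ℕ} {A : Matrix (Fin m) (Fin m) ℂ} {B : Matrix (Fin m) (Fin n) ℂ}
    {B' : Matrix (Fin n) (Fin m) ℂ}
    {C : Matrix (Fin n) (Fin n) ℂ} (u x : Fin m → ℂ) (v y : Fin n → ℂ) :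
    (Sum.elim u v) ⬝ᵥ (fromBlocks A B B' C *ᵥ Sum.elim x y)
      = u ⬝ᵥ (A *ᵥ x) + u ⬝ᵥ (B *ᵥ y) + v ⬝ᵥ (B' *ᵥ x) + v ⬝ᵥ (C *ᵥ y) := by
  rw [fromBlocks_mulVec, sumElim_dotProduct_sumElim]
  simp only [Sum.elim_comp_inl, Sum.elim_comp_inr, dotProduct_add]
  ring

lemma cv_elim {m n : ℕ} (x : Fin m → ℝ) (y : Fin n → ℝ) :
    cv (Sum.elim x y) = Sum.elim (cv x) (cv y) := by
  ext i; cases i <;> rfl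

lemma star_elim {m n : ℕ} (x : Fin m → ℂ) (y : Fin n → ℂ) :
    star (Sum.elim x y) = Sum.elim (star x) (star y) := by
  ext i; cases i <;> rfl

lemma star_cv {m : ℕ} (x : Fin m → ℝ) : star (cv x) = cv x := by
  ext i; simp [cv]

section alg
variable {m n q : ℕ}
    {A : Matrix (Fin m) (Fin m) ℂ} {B : Matrix (Fin m) (Fin q) ℂ}
    {C : Matrix (Fin q) (Fin q) ℂ}
    {K : Matrix (Fin q) (Fin q) ℂ} {L : Matrix (Fin q) (Fin n) ℂ}
    {M : Matrix (Fin n) (Fin n) ℂ}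

lemma CK_neg (hsym₁ : (fromBlocks A B Bᵀ C)ᵀ = fromBlocks A B Bᵀ C)
    (hsym₂ : (fromBlocks K L Lᵀ M)ᵀ = fromBlocks K L Lᵀ M)
    (hneg₁ : (-((fromBlocks A B Bᵀ C).map Complex.re)).PosDef)
    (hneg₂ : (-((fromBlocks K L Lᵀ M).map Complex.re)).PosDef) (s : Fin q → ℂ) (hs : s ≠ 0) :
    (star s ⬝ᵥ ((C + K) *ᵥ s)).re < 0 := by
  have h1 := herm_neg _ hsym₁ hneg₁ (Sum.elim 0 s) (by
    intro h; apply hs; ext i; exact congrFun h (Sum.inr i))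
  have h2 := herm_neg _ hsym₂ hneg₂ (Sum.elim s 0) (by
    intro h; apply hs; ext i; exact congrFun h (Sum.inl i))
  rw [star_elim, form_blocks] at h1 h2
  simp at h1 h2
  rw [add_mulVec, dotProduct_add, Complex.add_re]
  linarith

lemma CK_unit (hsym₁ : (fromBlocks A B Bᵀ C)ᵀ = fromBlocks A B Bᵀ C)
    (hsym₂ : (fromBlocks K L Lᵀ M)ᵀ = fromBlocks K L Lᵀ M)
    (hneg₁ : (-((fromBlocks A B Bᵀ C).map Complex.re)).PosDef)
    (hneg₂ : (-((fromBlocks K L Lᵀ M).map Complex.re)).PosDef) : IsUnit (C + K).det := by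
  rw [isUnit_iff_ne_zero]
  intro h
  obtain ⟨s, hs, h0⟩ := exists_mulVec_eq_zero_iff.mpr h
  have := CK_neg hsym₁ hsym₂ hneg₁ hneg₂ s hs
  rw [h0] at this
  simp at this

lemma posdef_of_cv {ι : Type*} [Fintype ι] (S : Matrix ι ι ℂ) (hS : Sᵀ = S)
    (h : ∀ x : ι → ℝ, x ≠ 0 → (cv x ⬝ᵥ (S *ᵥ cv x)).re < 0) :
    (-(S.map Complex.re)).PosDef := by
  refine PosDef.of_dotProduct_mulVec_pos ?_ ?_
  · rw [Matrix.IsHermitian, conjTranspose_eq_transpose_of_trivial, transpose_neg, ← transpose_map,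
      hS]
  · intro x hx
    have := h x hx
    rw [re_cv] at this
    simp only [star_trivial, neg_mulVec, dotProduct_neg]
    linarith

lemma CK_posdef (hsym₁ : (fromBlocks A B Bᵀ C)ᵀ = fromBlocks A B Bᵀ C)
    (hsym₂ : (fromBlocks K L Lᵀ M)ᵀ = fromBlocks K L Lᵀ M)
    (hneg₁ : (-((fromBlocks A B Bᵀ C).map Complex.re)).PosDef)
    (hneg₂ : (-((fromBlocks K L Lᵀ M).map Complex.re)).PosDef) (hs : (C + K)ᵀ = C + K) :
    ((-(C + K)).map Complex.re).PosDef := by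
  have := posdef_of_cv (C + K) hs (fun x hx => by
    have := CK_neg hsym₁ hsym₂ hneg₁ hneg₂ (cv x) (by
      intro h; apply hx; ext i
      have := congrFun h i
      simpa [cv] using this)
    rwa [star_cv] at this)
  have h2 : (-(C + K)).map Complex.re = -((C + K).map Complex.re) := by ext; simp
  rwa [h2]

lemma S3_form (x : Fin m → ℂ) (y : Fin n → ℂ) :
    Sum.elim x y ⬝ᵥ (fromBlocks
      (A - B * (C + K)⁻¹ * Bᵀ) (-(B * (C + K)⁻¹ * L))
      (-(Lᵀ * (C + K)⁻¹ * Bᵀ)) (M - Lᵀ * (C + K)⁻¹ * L) *ᵥ Sum.elim x y)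
    = x ⬝ᵥ (A *ᵥ x) + y ⬝ᵥ (M *ᵥ y)
      - (Bᵀ *ᵥ x + L *ᵥ y) ⬝ᵥ ((C + K)⁻¹ *ᵥ (Bᵀ *ᵥ x + L *ᵥ y)) := by
  rw [form_blocks]
  have hB : ∀ z, x ⬝ᵥ (B *ᵥ z) = (Bᵀ *ᵥ x) ⬝ᵥ z := fun z => by
    rw [dotProduct_mulVec, mulVec_transpose]
  have hL : ∀ z, y ⬝ᵥ (Lᵀ *ᵥ z) = (L *ᵥ y) ⬝ᵥ z := fun z => by
    rw [dotProduct_mulVec, vecMul_transpose]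
  simp only [sub_mulVec, neg_mulVec, ← mulVec_mulVec, dotProduct_sub, dotProduct_neg, hB, hL,
    mulVec_add, dotProduct_add, add_dotProduct]
  ring

lemma S3_neg (hsym₁ : (fromBlocks A B Bᵀ C)ᵀ = fromBlocks A B Bᵀ C)
    (hsym₂ : (fromBlocks K L Lᵀ M)ᵀ = fromBlocks K L Lᵀ M)
    (hneg₁ : (-((fromBlocks A B Bᵀ C).map Complex.re)).PosDef)
    (hneg₂ : (-((fromBlocks K L Lᵀ M).map Complex.re)).PosDef) (hs : (C + K)ᵀ = C + K)
    (x : Fin m → ℝ) (y : Fin n → ℝ) (hxy : Sum.elim x y ≠ 0) :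
    (cv (Sum.elim x y) ⬝ᵥ (fromBlocks
      (A - B * (C + K)⁻¹ * Bᵀ) (-(B * (C + K)⁻¹ * L))
      (-(Lᵀ * (C + K)⁻¹ * Bᵀ)) (M - Lᵀ * (C + K)⁻¹ * L) *ᵥ cv (Sum.elim x y))).re < 0 := by
  have hu := CK_unit hsym₁ hsym₂ hneg₁ hneg₂
  set v := Bᵀ *ᵥ cv x + L *ᵥ cv y with hv
  set s := -((C + K)⁻¹ *ᵥ v) with hsd
  have hcrit : (C + K) *ᵥ s = - v := by
    rw [hsd, mulVec_neg, mulVec_mulVec, mul_nonsing_inv _ hu, one_mulVec]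
  have hB : ∀ z, cv x ⬝ᵥ (B *ᵥ z) = (Bᵀ *ᵥ cv x) ⬝ᵥ z := fun z => by
    rw [dotProduct_mulVec, mulVec_transpose]
  have hL : ∀ z, cv y ⬝ᵥ (Lᵀ *ᵥ z) = (L *ᵥ cv y) ⬝ᵥ z := fun z => by
    rw [dotProduct_mulVec, vecMul_transpose]
  have key : cv (Sum.elim x y) ⬝ᵥ (fromBlocks
      (A - B * (C + K)⁻¹ * Bᵀ) (-(B * (C + K)⁻¹ * L))
      (-(Lᵀ * (C + K)⁻¹ * Bᵀ)) (M - Lᵀ * (C + K)⁻¹ * L) *ᵥ cv (Sum.elim x y))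
      = star (Sum.elim (cv x) s) ⬝ᵥ (fromBlocks A B Bᵀ C *ᵥ Sum.elim (cv x) s)
        + star (Sum.elim s (cv y)) ⬝ᵥ (fromBlocks K L Lᵀ M *ᵥ Sum.elim s (cv y)) := by
    rw [cv_elim, S3_form, star_elim, star_elim, form_blocks, form_blocks, star_cv, star_cv,
      hB, hL]
    have e1 : star s ⬝ᵥ (C *ᵥ s) + star s ⬝ᵥ (K *ᵥ s)
        + star s ⬝ᵥ (Bᵀ *ᵥ cv x) + star s ⬝ᵥ (L *ᵥ cv y) = 0 := by
      rw [← dotProduct_add, ← dotProduct_add, ← dotProduct_add, ← add_mulVec, hcrit, add_assoc,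
        ← hv]
      simp
    have e2 : v ⬝ᵥ ((C + K)⁻¹ *ᵥ v) = - (v ⬝ᵥ s) := by rw [hsd]; simp
    rw [← hv, e2, hv, add_dotProduct]
    linear_combination -e1
  rw [key, Complex.add_re]
  have n1 := herm_nonpos _ hsym₁ hneg₁ (Sum.elim (cv x) s)
  have n2 := herm_nonpos _ hsym₂ hneg₂ (Sum.elim s (cv y))
  by_cases hx : x = 0
  · have hy : y ≠ 0 := by
      rintro rfl
      subst hx
      apply hxy
      ext i; cases i <;> rfl
    have := herm_neg _ hsym₂ hneg₂ (Sum.elim s (cv y)) (by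
      intro h; apply hy; ext i
      have := congrFun h (Sum.inr i)
      simpa [cv] using this)
    linarith
  · have := herm_neg _ hsym₁ hneg₁ (Sum.elim (cv x) s) (by
      intro h; apply hx; ext i
      have := congrFun h (Sum.inl i)
      simpa [cv] using this)
    linarith

lemma S3_symm (hsym₁ : (fromBlocks A B Bᵀ C)ᵀ = fromBlocks A B Bᵀ C)
    (hsym₂ : (fromBlocks K L Lᵀ M)ᵀ = fromBlocks K L Lᵀ M) :
    (C + K)ᵀ = C + K ∧ (fromBlocks
      (A - B * (C + K)⁻¹ * Bᵀ) (-(B * (C + K)⁻¹ * L))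
      (-(Lᵀ * (C + K)⁻¹ * Bᵀ)) (M - Lᵀ * (C + K)⁻¹ * L))ᵀ = fromBlocks
      (A - B * (C + K)⁻¹ * Bᵀ) (-(B * (C + K)⁻¹ * L))
      (-(Lᵀ * (C + K)⁻¹ * Bᵀ)) (M - Lᵀ * (C + K)⁻¹ * L) := by
  rw [fromBlocks_transpose, fromBlocks_inj] at hsym₁ hsym₂
  obtain ⟨hA, -, -, hC⟩ := hsym₁
  obtain ⟨hK, -, -, hM⟩ := hsym₂
  have h : (C + K)ᵀ = C + K := by rw [transpose_add, hC, hK]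
  refine ⟨h, ?_⟩
  have hi : ((C + K)⁻¹)ᵀ = (C + K)⁻¹ := by rw [transpose_nonsing_inv, h]
  rw [fromBlocks_transpose]
  simp only [transpose_sub, transpose_neg, transpose_mul, transpose_transpose, hi, hA, hM,
    Matrix.mul_assoc]
end alg

lemma summ1 (a : ℝ) (ha : 0 < a) : Summable (fun k : ℤ => Real.exp (-a * (k : ℝ) ^ 2)) := by
  have hτ : 0 < (Complex.I * (a / π : ℝ) : ℂ).im := by
    have := div_pos ha Real.pi_pos
    simpa using this
  have h := (hasSum_jacobiTheta₂_term 0 hτ).summable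
  refine h.norm.congr fun k => ?_
  rw [jacobiTheta₂_term, Complex.norm_exp]
  congr 1
  have : (2 * π * Complex.I * k * 0 + π * Complex.I * (k : ℂ) ^ 2 * (Complex.I * (a / π : ℝ)) : ℂ)
      = ((-a * (k : ℝ) ^ 2 : ℝ) : ℂ) := by
    push_cast
    have : (π : ℂ) ≠ 0 := by exact_mod_cast Real.pi_ne_zero
    field_simp
    linear_combination (k:ℂ) ^ 2 * a * Complex.I_sq
  rw [this, Complex.ofReal_re]

lemma summ_pi (f : ℤ → ℝ) (hf : Summable f) (hf0 : ∀ k, 0 ≤ f k) (m : ℕ) :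
    Summable (fun k : Fin m → ℤ => ∏ i, f (k i)) := by
  induction m with
  | zero => exact Summable.of_finite
  | succ m ih =>
    rw [← (Fin.consEquiv (fun _ : Fin (m+1) => ℤ)).summable_iff]
    have := hf.mul_of_nonneg ih hf0 (fun k => Finset.prod_nonneg fun i _ => hf0 _)
    refine this.congr fun p => ?_
    simp [Fin.consEquiv, Fin.prod_univ_succ]

def thTerm {m n : ℕ} (S : Matrix (Fin m ⊕ Fin n) (Fin m ⊕ Fin n) ℂ)
    (x ξ : Fin m → ℝ) (y η : Fin n → ℝ) (kl : (Fin m → ℤ) × (Fin n → ℤ)) : ℂ :=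
    Complex.exp ((1 / 2 : ℂ) *
        qf S (fun i => x i + 2 * π * kl.1 i) (fun i => y i + 2 * π * kl.2 i))
      * Complex.exp (Complex.I * ∑ i, (kl.1 i : ℂ) * (ξ i : ℂ))
      * Complex.exp (-Complex.I * ∑ i, (kl.2 i : ℂ) * (η i : ℂ))

lemma norm_qf {m n : ℕ} (S : Matrix (Fin m ⊕ Fin n) (Fin m ⊕ Fin n) ℂ)
    (hneg : (-(S.map Complex.re)).PosDef) :
    ∃ c > 0, ∀ (x : Fin m → ℝ) (y : Fin n → ℝ), ‖Complex.exp ((1 / 2 : ℂ) * qf S x y)‖ ≤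
      Real.exp (-c * (∑ i, x i ^ 2 + ∑ i, y i ^ 2)) := by
  obtain ⟨c, hc, h⟩ := posdef_bound _ hneg
  refine ⟨c / 2, by positivity, fun x y => ?_⟩
  rw [Complex.norm_exp]
  apply Real.exp_le_exp.mpr
  have h1 := h (Sum.elim x y)
  rw [neg_mulVec, dotProduct_neg, ← re_cv, Fintype.sum_sum_type] at h1
  simp only [Sum.elim_inl, Sum.elim_inr] at h1
  have h2 : ((1 / 2 : ℂ) * qf S x y).re = 1 / 2 * (qf S x y).re := by
    simp [Complex.mul_re]
  rw [h2, qf]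
  linarith

lemma norm_phase {m : ℕ} (k : Fin m → ℤ) (ξ : Fin m → ℝ) :
    ‖Complex.exp (Complex.I * ∑ i, (k i : ℂ) * (ξ i : ℂ))‖ = 1 := by
  have : (∑ i, (k i : ℂ) * (ξ i : ℂ)) = ((∑ i, (k i : ℝ) * ξ i : ℝ) : ℂ) := by push_cast; rfl
  rw [this, mul_comm, Complex.norm_exp_ofReal_mul_I]

lemma norm_phase' {m : ℕ} (k : Fin m → ℤ) (ξ : Fin m → ℝ) :
    ‖Complex.exp (-Complex.I * ∑ i, (k i : ℂ) * (ξ i : ℂ))‖ = 1 := by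
  have : (-Complex.I * ∑ i, (k i : ℂ) * (ξ i : ℂ)) = ((-∑ i, (k i : ℝ) * ξ i : ℝ) : ℂ) * Complex.I := by
    push_cast; ring
  rw [this, Complex.norm_exp_ofReal_mul_I]

lemma aux_sq (c : ℝ) (hc : 0 < c) (r : ℕ) (z : Fin r → ℝ) (k : Fin r → ℤ) :
      -c * ∑ i, (z i + 2 * π * k i) ^ 2 ≤ c * ∑ i, z i ^ 2
        + ∑ i, -(2 * π ^ 2 * c) * (k i : ℝ) ^ 2 := by
  rw [Finset.mul_sum, Finset.mul_sum, ← Finset.sum_add_distrib]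
  refine Finset.sum_le_sum fun i _ => ?_
  have := mul_nonneg hc.le (sq_nonneg (2 * z i + 2 * π * k i))
  nlinarith

lemma term_bound {m n : ℕ} (S : Matrix (Fin m ⊕ Fin n) (Fin m ⊕ Fin n) ℂ)
    (hneg : (-(S.map Complex.re)).PosDef) :
    ∃ c > 0, ∃ W : (Fin m → ℤ) × (Fin n → ℤ) → ℝ, Summable W ∧ (∀ a, 0 ≤ W a) ∧
      ∀ x ξ y η a, ‖thTerm S x ξ y η a‖ ≤ Real.exp (c * (∑ i, x i ^ 2 + ∑ i, y i ^ 2)) * W a := by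
  obtain ⟨c, hc, h⟩ := norm_qf S hneg
  obtain ⟨f, hf⟩ : ∃ f : ℤ → ℝ, f = fun k : ℤ => Real.exp (-(2 * π ^ 2 * c) * (k : ℝ) ^ 2) := ⟨_, rfl⟩
  have hfs : Summable f := by rw [hf]; exact summ1 _ (by positivity)
  have hf0 : ∀ k, 0 ≤ f k := fun k => by rw [hf]; exact (Real.exp_pos _).le
  have hp0 : ∀ (r : ℕ) (k : Fin r → ℤ), 0 ≤ ∏ i, f (k i) :=
    fun r k => Finset.prod_nonneg fun i _ => hf0 _
  have hsum := (summ_pi f hfs hf0 m).mul_of_nonneg (summ_pi f hfs hf0 n) (hp0 m) (hp0 n)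
  refine ⟨c, hc, fun a => (∏ i, f (a.1 i)) * ∏ i, f (a.2 i), hsum,
    fun a => mul_nonneg (hp0 _ _) (hp0 _ _), fun x ξ y η a => ?_⟩
  rw [thTerm, norm_mul, norm_mul, norm_phase, norm_phase', mul_one, mul_one]
  refine (h _ _).trans ?_
  rw [hf]
  simp only [← Real.exp_sum, ← Real.exp_add]
  apply Real.exp_le_exp.mpr
  have a1 := aux_sq c hc m x a.1
  have a2 := aux_sq c hc n y a.2
  linarith

lemma cont_qf {m n : ℕ} (S : Matrix (Fin m ⊕ Fin n) (Fin m ⊕ Fin n) ℂ) :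
    Continuous (fun p : (Fin m → ℝ) × (Fin n → ℝ) => qf S p.1 p.2) := by
  have : Continuous (fun p : (Fin m → ℝ) × (Fin n → ℝ) => cv (Sum.elim p.1 p.2)) := by
    apply cont_cv.comp
    refine continuous_pi fun i => ?_
    cases i
    · simp only [Sum.elim_inl]; fun_prop
    · simp only [Sum.elim_inr]; fun_prop
  exact this.dotProduct (continuous_const.matrix_mulVec this)

lemma cont_term {m n : ℕ} (S : Matrix (Fin m ⊕ Fin n) (Fin m ⊕ Fin n) ℂ) (a) :
    Continuous (fun p : ((Fin m → ℝ) × (Fin m → ℝ)) × ((Fin n → ℝ) × (Fin n → ℝ)) =>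
      thTerm S p.1.1 p.1.2 p.2.1 p.2.2 a) := by
  unfold thTerm
  refine Continuous.mul (Continuous.mul (Complex.continuous_exp.comp (continuous_const.mul ?_)) ?_) ?_
  · refine (cont_qf S).comp (f := fun p : ((Fin m → ℝ) × (Fin m → ℝ)) × ((Fin n → ℝ) × (Fin n → ℝ)) =>
      ((fun i => p.1.1 i + 2 * π * a.1 i), (fun i => p.2.1 i + 2 * π * a.2 i))) ?_
    fun_prop
  · fun_prop
  · fun_prop

lemma summ_term {m n : ℕ} (S : Matrix (Fin m ⊕ Fin n) (Fin m ⊕ Fin n) ℂ)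
    (hneg : (-(S.map Complex.re)).PosDef) (x ξ y η) : Summable (fun a => ‖thTerm S x ξ y η a‖) := by
  obtain ⟨c, hc, W, hW, -, h⟩ := term_bound S hneg
  exact Summable.of_nonneg_of_le (fun _ => norm_nonneg _) (h x ξ y η) (hW.mul_left _)

lemma cont_kernel {m n : ℕ} (S : Matrix (Fin m ⊕ Fin n) (Fin m ⊕ Fin n) ℂ)
    (hneg : (-(S.map Complex.re)).PosDef) :
    Continuous (fun p : ((Fin m → ℝ) × (Fin m → ℝ)) × ((Fin n → ℝ) × (Fin n → ℝ)) =>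
      thetaKernel S p.1.1 p.1.2 p.2.1 p.2.2) := by
  obtain ⟨c, hc, W, hW, hW0, h⟩ := term_bound S hneg
  rw [continuous_iff_continuousAt]
  intro p₀
  set N : ((Fin m → ℝ) × (Fin m → ℝ)) × ((Fin n → ℝ) × (Fin n → ℝ)) → ℝ :=
    fun p => ∑ i, p.1.1 i ^ 2 + ∑ i, p.2.1 i ^ 2 with hN
  have hNc : Continuous N := by fun_prop
  have hU : IsOpen {p | N p < N p₀ + 1} := isOpen_lt hNc continuous_const
  have hon : ContinuousOn (fun p : ((Fin m → ℝ) × (Fin m → ℝ)) × ((Fin n → ℝ) × (Fin n → ℝ)) =>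
      ∑' a, thTerm S p.1.1 p.1.2 p.2.1 p.2.2 a) {p | N p < N p₀ + 1} := by
    refine continuousOn_tsum (u := fun a => Real.exp (c * (N p₀ + 1)) * W a)
      (fun a => (cont_term S a).continuousOn) (hW.mul_left _) ?_
    intro a p hp
    refine (h _ _ _ _ a).trans (mul_le_mul_of_nonneg_right ?_ (hW0 a))
    apply Real.exp_le_exp.mpr
    exact mul_le_mul_of_nonneg_left (le_of_lt hp) hc.le
  exact hon.continuousAt (hU.mem_nhds (by simp))

lemma unfold_sum {q : ℕ} (F : (Fin q → ℝ) → ℂ) (hF : Integrable F) :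
    HasSum (fun l : Fin q → ℤ => ∫ s in Set.Icc (0 : Fin q → ℝ) (fun _ => 2 * π),
      F (fun i => s i + 2 * π * l i)) (∫ s, F s) := by
  have h2pi : (0 : ℝ) < 2 * π := by positivity
  set D : (Fin q → ℤ) → Set (Fin q → ℝ) := fun l =>
    Set.pi Set.univ (fun i => Set.Ico (2 * π * l i) (2 * π * l i + 2 * π)) with hD
  have hmem : ∀ l s, s ∈ D l ↔ ∀ i, ⌊s i / (2 * π)⌋ = l i := by
    intro l s
    simp only [hD, Set.mem_univ_pi, Set.mem_Ico, Int.floor_eq_iff]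
    refine forall_congr' fun i => ?_
    rw [le_div_iff₀ h2pi, div_lt_iff₀ h2pi]
    constructor <;> rintro ⟨h1, h2⟩ <;> constructor <;> linarith
  have hm : ∀ l, MeasurableSet (D l) := fun l =>
    MeasurableSet.univ_pi fun i => measurableSet_Ico
  have hd : Pairwise (Function.onFun Disjoint D) := by
    intro l l' hll
    rw [Function.onFun, Set.disjoint_left]
    intro s h1 h2
    rw [hmem] at h1 h2
    exact hll (funext fun i => (h1 i).symm.trans (h2 i))
  have hun : (⋃ l, D l) = Set.univ := by
    ext s
    simp only [Set.mem_iUnion, Set.mem_univ, iff_true]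
    exact ⟨fun i => ⌊s i / (2 * π)⌋, (hmem _ _).mpr fun i => rfl⟩
  have hs := hasSum_integral_iUnion hm hd (f := F) (μ := volume) (by rw [hun]; exact hF.integrableOn)
  rw [hun, setIntegral_univ] at hs
  suffices hfun : ∀ l : Fin q → ℤ, ∫ s in Set.Icc (0 : Fin q → ℝ) (fun _ => 2 * π),
      F (fun i => s i + 2 * π * l i) = ∫ s in D l, F s by
    simp only [hfun]
    exact hs
  intro l
  have hae : (Set.Icc (0 : Fin q → ℝ) (fun _ => 2 * π)) =ᵐ[volume] D 0 := by
    have := Measure.univ_pi_Ico_ae_eq_Icc (μ := fun _ : Fin q => (volume : Measure ℝ))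
      (f := 0) (g := fun _ => 2 * π)
    refine this.symm.trans (Filter.EventuallyEq.of_eq ?_)
    simp [hD]
    rfl
  rw [setIntegral_congr_set hae]
  set v : Fin q → ℝ := fun i => 2 * π * l i with hv
  have hpre : (fun s => s + v) ⁻¹' (D l) = D 0 := by
    ext s
    simp only [Set.mem_preimage, hD, Set.mem_univ_pi, Set.mem_Ico, hv, Pi.add_apply, Pi.zero_apply]
    refine forall_congr' fun i => ?_
    push_cast
    constructor <;> rintro ⟨h1, h2⟩ <;> constructor <;> linarith
  have := (measurePreserving_add_right (volume : Measure (Fin q → ℝ)) v).setIntegral_preimage_emb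
    (measurableEmbedding_addRight v) F (D l)
  rw [hpre] at this
  exact this

lemma phase1 (n : ℤ) : ∫ z in Set.Icc (0:ℝ) (2 * π), Complex.exp (Complex.I * n * z)
    = if n = 0 then (2 * π : ℂ) else 0 := by
  rw [integral_Icc_eq_integral_Ioc, ← intervalIntegral.integral_of_le (by positivity)]
  split_ifs with h
  · subst h; simp
  · have hn : (Complex.I * n : ℂ) ≠ 0 := by simp [h]
    rw [integral_exp_mul_complex hn]
    have : Complex.exp (Complex.I * n * ((2 * π : ℝ) : ℂ)) = 1 := by
      rw [← Complex.exp_int_mul_two_pi_mul_I n]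
      congr 1; push_cast; ring
    rw [this]; simp

lemma phaseq {q : ℕ} (l l' : Fin q → ℤ) :
    ∫ z in Set.Icc (0 : Fin q → ℝ) (fun _ => 2 * π),
      Complex.exp (-Complex.I * ∑ i, (l i : ℂ) * (z i : ℂ)) *
      Complex.exp (Complex.I * ∑ i, (l' i : ℂ) * (z i : ℂ)) = if l = l' then (2 * π : ℂ) ^ q else 0 := by
  have h1 : ∀ z : Fin q → ℝ, Complex.exp (-Complex.I * ∑ i, (l i : ℂ) * (z i : ℂ)) *
      Complex.exp (Complex.I * ∑ i, (l' i : ℂ) * (z i : ℂ))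
      = ∏ i, Complex.exp (Complex.I * ((l' i - l i : ℤ) : ℂ) * (z i : ℂ)) := by
    intro z
    rw [← Complex.exp_add, ← Complex.exp_sum]
    congr 1
    rw [Finset.mul_sum, Finset.mul_sum, ← Finset.sum_add_distrib]
    refine Finset.sum_congr rfl fun i _ => ?_
    push_cast; ring
  simp only [h1]
  rw [← Set.pi_univ_Icc, volume_pi, Measure.restrict_pi_pi,
    integral_fintype_prod_eq_prod
      (f := fun i (z : ℝ) => Complex.exp (Complex.I * ((l' i - l i : ℤ) : ℂ) * (z : ℂ)))]
  simp only [Pi.zero_apply, phase1]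
  split_ifs with h
  · subst h; simp
  · obtain ⟨i, hi⟩ := Function.ne_iff.mp h
    apply Finset.prod_eq_zero (Finset.mem_univ i)
    rw [if_neg]
    intro h'
    exact hi (sub_eq_zero.mp h').symm

lemma integrable_F {m n q : ℕ} (S₁ : Matrix (Fin m ⊕ Fin q) (Fin m ⊕ Fin q) ℂ)
    (S₂ : Matrix (Fin q ⊕ Fin n) (Fin q ⊕ Fin n) ℂ)
    (hneg₁ : (-(S₁.map Complex.re)).PosDef)
    (hneg₂ : (-(S₂.map Complex.re)).PosDef) (X : Fin m → ℝ) (Y : Fin n → ℝ) :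
    Integrable (fun s : Fin q → ℝ => Complex.exp ((1 / 2 : ℂ) * qf S₁ X s)
      * Complex.exp ((1 / 2 : ℂ) * qf S₂ s Y)) := by
  obtain ⟨c, hc, h1⟩ := norm_qf S₁ hneg₁
  obtain ⟨c', hc', h2⟩ := norm_qf S₂ hneg₂
  have hg : Integrable (fun s : Fin q → ℝ => ∏ i, Real.exp (-c * (s i) ^ 2)) :=
    Integrable.fintype_prod (f := fun _ z => Real.exp (-c * z ^ 2))
      (fun _ => integrable_exp_neg_mul_sq hc)
  refine hg.mono' ?_ (Filter.Eventually.of_forall fun s => ?_)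
  · apply Continuous.aestronglyMeasurable
    refine Continuous.mul (Complex.continuous_exp.comp (continuous_const.mul ?_))
      (Complex.continuous_exp.comp (continuous_const.mul ?_))
    · exact (cont_qf S₁).comp (f := fun s => (X, s)) (by fun_prop)
    · exact (cont_qf S₂).comp (f := fun s => (s, Y)) (by fun_prop)
  · rw [norm_mul, ← Real.exp_sum, ← Finset.mul_sum]
    have a1 : ‖Complex.exp ((1 / 2 : ℂ) * qf S₁ X s)‖ ≤ Real.exp (-c * ∑ i, s i ^ 2) := by
      refine (h1 X s).trans (Real.exp_le_exp.mpr ?_)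
      have : 0 ≤ ∑ i, X i ^ 2 := Finset.sum_nonneg fun i _ => sq_nonneg _
      nlinarith
    have a2 : ‖Complex.exp ((1 / 2 : ℂ) * qf S₂ s Y)‖ ≤ 1 := by
      refine (h2 s Y).trans (Real.exp_le_one_iff.mpr ?_)
      have : 0 ≤ ∑ i, Y i ^ 2 := Finset.sum_nonneg fun i _ => sq_nonneg _
      have : 0 ≤ ∑ i, s i ^ 2 := Finset.sum_nonneg fun i _ => sq_nonneg _
      nlinarith
    calc _ ≤ Real.exp (-c * ∑ i, s i ^ 2) * 1 :=
          mul_le_mul a1 a2 (norm_nonneg _) (Real.exp_pos _).le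
      _ = _ := mul_one _

lemma term_int {m n q : ℕ} (S₁ : Matrix (Fin m ⊕ Fin q) (Fin m ⊕ Fin q) ℂ)
    (S₂ : Matrix (Fin q ⊕ Fin n) (Fin q ⊕ Fin n) ℂ)
    (x ξ : Fin m → ℝ) (y η : Fin n → ℝ) (k : Fin m → ℤ) (l l' : Fin q → ℤ) (j : Fin n → ℤ) :
    ∫ p in Set.Icc ((0, 0) : (Fin q → ℝ) × (Fin q → ℝ)) ((fun _ => 2 * π), (fun _ => 2 * π)),
      thTerm S₁ x ξ p.1 p.2 (k, l) * thTerm S₂ p.1 p.2 y η (l', j)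
    = (Complex.exp (Complex.I * ∑ i, (k i : ℂ) * (ξ i : ℂ)) *
        Complex.exp (-Complex.I * ∑ i, (j i : ℂ) * (η i : ℂ))) *
      ((∫ s in Set.Icc (0 : Fin q → ℝ) (fun _ => 2 * π),
        Complex.exp ((1 / 2 : ℂ) *
          qf S₁ (fun i => x i + 2 * π * k i) (fun i => s i + 2 * π * l i)) *
        Complex.exp ((1 / 2 : ℂ) *
          qf S₂ (fun i => s i + 2 * π * l' i) (fun i => y i + 2 * π * j i))) *
      (if l = l' then (2 * π : ℂ) ^ q else 0)) := by
  rw [← phaseq l l', ← Set.Icc_prod_Icc, Measure.volume_eq_prod, ← setIntegral_prod_mul,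
    ← integral_const_mul]
  congr 1
  ext p
  simp only [thTerm]
  ring

lemma gauss_comp {m n q : ℕ}
    {A : Matrix (Fin m) (Fin m) ℂ} {B : Matrix (Fin m) (Fin q) ℂ}
    {C : Matrix (Fin q) (Fin q) ℂ}
    {K : Matrix (Fin q) (Fin q) ℂ} {L : Matrix (Fin q) (Fin n) ℂ}
    {M : Matrix (Fin n) (Fin n) ℂ}
    (hsym₁ : (fromBlocks A B Bᵀ C)ᵀ = fromBlocks A B Bᵀ C)
    (hsym₂ : (fromBlocks K L Lᵀ M)ᵀ = fromBlocks K L Lᵀ M)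
    (hneg₁ : (-((fromBlocks A B Bᵀ C).map Complex.re)).PosDef)
    (hneg₂ : (-((fromBlocks K L Lᵀ M).map Complex.re)).PosDef) :
    ∃ lam : ℂ, lam ^ 2 = ((-(C + K)).det)⁻¹ ∧ ∀ (X : Fin m → ℝ) (Y : Fin n → ℝ),
      ∫ s : Fin q → ℝ, Complex.exp ((1 / 2 : ℂ) * qf (fromBlocks A B Bᵀ C) X s)
        * Complex.exp ((1 / 2 : ℂ) * qf (fromBlocks K L Lᵀ M) s Y)
      = (((2 * π) ^ ((q : ℝ) / 2) : ℝ) : ℂ) * lam * Complex.exp ((1 / 2 : ℂ) * qf (fromBlocks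
      (A - B * (C + K)⁻¹ * Bᵀ) (-(B * (C + K)⁻¹ * L))
      (-(Lᵀ * (C + K)⁻¹ * Bᵀ)) (M - Lᵀ * (C + K)⁻¹ * L)) X Y) := by
  have hs := (S3_symm hsym₁ hsym₂).1
  obtain ⟨lam, h1, h2⟩ := gauss q (-(C + K)) (by rw [transpose_neg, hs])
    (CK_posdef hsym₁ hsym₂ hneg₁ hneg₂ hs)
  refine ⟨lam, h1, fun X Y => ?_⟩
  have hu := CK_unit hsym₁ hsym₂ hneg₁ hneg₂
  have hinv : (-(C + K))⁻¹ = -(C + K)⁻¹ := by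
    apply inv_eq_right_inv
    rw [neg_mul_neg, mul_nonsing_inv _ hu]
  have h3 := h2 (Bᵀ *ᵥ cv X + L *ᵥ cv Y)
  rw [hinv] at h3
  have e3 : qf (fromBlocks
      (A - B * (C + K)⁻¹ * Bᵀ) (-(B * (C + K)⁻¹ * L))
      (-(Lᵀ * (C + K)⁻¹ * Bᵀ)) (M - Lᵀ * (C + K)⁻¹ * L)) X Y = cv X ⬝ᵥ (A *ᵥ cv X) + cv Y ⬝ᵥ (M *ᵥ cv Y)
      - (Bᵀ *ᵥ cv X + L *ᵥ cv Y) ⬝ᵥ ((C + K)⁻¹ *ᵥ (Bᵀ *ᵥ cv X + L *ᵥ cv Y)) := by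
    rw [qf, cv_elim, S3_form]
  have e4 : ∀ s : Fin q → ℝ, Complex.exp ((1 / 2 : ℂ) * qf (fromBlocks A B Bᵀ C) X s)
        * Complex.exp ((1 / 2 : ℂ) * qf (fromBlocks K L Lᵀ M) s Y)
      = Complex.exp ((1/2) * (cv X ⬝ᵥ (A *ᵥ cv X) + cv Y ⬝ᵥ (M *ᵥ cv Y))) *
        Complex.exp (-(1/2) * (cv s ⬝ᵥ (-(C + K) *ᵥ cv s))
          + (Bᵀ *ᵥ cv X + L *ᵥ cv Y) ⬝ᵥ cv s) := by
    intro s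
    rw [← Complex.exp_add, ← Complex.exp_add, qf, qf, cv_elim, cv_elim, form_blocks, form_blocks]
    have hB : cv X ⬝ᵥ (B *ᵥ cv s) = (Bᵀ *ᵥ cv X) ⬝ᵥ cv s := by
      rw [dotProduct_mulVec, mulVec_transpose]
    have hL : cv Y ⬝ᵥ (Lᵀ *ᵥ cv s) = (L *ᵥ cv Y) ⬝ᵥ cv s := by
      rw [dotProduct_mulVec, vecMul_transpose]
    rw [hB, hL, neg_mulVec, dotProduct_neg, add_mulVec, dotProduct_add, add_dotProduct,
      dotProduct_comm (cv s) (Bᵀ *ᵥ cv X), dotProduct_comm (cv s) (L *ᵥ cv Y)]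
    congr 1
    ring
  simp only [e4]
  rw [integral_const_mul, h3, e3, mul_left_comm, ← Complex.exp_add]
  congr 2
  rw [neg_mulVec, dotProduct_neg]
  ring

lemma kernel_int {m n q : ℕ} (S₁ : Matrix (Fin m ⊕ Fin q) (Fin m ⊕ Fin q) ℂ)
    (S₂ : Matrix (Fin q ⊕ Fin n) (Fin q ⊕ Fin n) ℂ)
    (hneg₁ : (-(S₁.map Complex.re)).PosDef)
    (hneg₂ : (-(S₂.map Complex.re)).PosDef) (x ξ : Fin m → ℝ) (y η : Fin n → ℝ) :
    HasSum (fun ab : ((Fin m → ℤ) × (Fin q → ℤ)) × ((Fin q → ℤ) × (Fin n → ℤ)) =>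
      ∫ p in Set.Icc ((0, 0) : (Fin q → ℝ) × (Fin q → ℝ)) ((fun _ => 2 * π), (fun _ => 2 * π)),
        thTerm S₁ x ξ p.1 p.2 ab.1 * thTerm S₂ p.1 p.2 y η ab.2)
      (∫ p in Set.Icc ((0, 0) : (Fin q → ℝ) × (Fin q → ℝ)) ((fun _ => 2 * π), (fun _ => 2 * π)),
        thetaKernel S₁ x ξ p.1 p.2 * thetaKernel S₂ p.1 p.2 y η) := by
  have hprod : ∀ p : (Fin q → ℝ) × (Fin q → ℝ),
      thetaKernel S₁ x ξ p.1 p.2 * thetaKernel S₂ p.1 p.2 y η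
      = ∑' ab : ((Fin m → ℤ) × (Fin q → ℤ)) × ((Fin q → ℤ) × (Fin n → ℤ)),
        thTerm S₁ x ξ p.1 p.2 ab.1 * thTerm S₂ p.1 p.2 y η ab.2 := fun p =>
    tsum_mul_tsum_of_summable_norm (summ_term S₁ hneg₁ x ξ p.1 p.2) (summ_term S₂ hneg₂ p.1 p.2 y η)
  simp only [hprod]
  have hc : ∀ ab : ((Fin m → ℤ) × (Fin q → ℤ)) × ((Fin q → ℤ) × (Fin n → ℤ)),
      Continuous (fun p : (Fin q → ℝ) × (Fin q → ℝ) =>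
        thTerm S₁ x ξ p.1 p.2 ab.1 * thTerm S₂ p.1 p.2 y η ab.2) := by
    intro ab
    refine Continuous.mul ?_ ?_
    · exact (cont_term S₁ ab.1).comp (f := fun p : (Fin q → ℝ) × (Fin q → ℝ) => ((x, ξ), p))
        (by fun_prop)
    · exact (cont_term S₂ ab.2).comp (f := fun p : (Fin q → ℝ) × (Fin q → ℝ) => (p, (y, η)))
        (by fun_prop)
  obtain ⟨c₁, hc₁, W₁, hW₁, hW₁0, hb₁⟩ := term_bound S₁ hneg₁
  obtain ⟨c₂, hc₂, W₂, hW₂, hW₂0, hb₂⟩ := term_bound S₂ hneg₂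
  set R : ℝ := ∑ _i : Fin q, (2 * π) ^ 2 with hR
  set box := Set.Icc ((0, 0) : (Fin q → ℝ) × (Fin q → ℝ)) ((fun _ => 2 * π), (fun _ => 2 * π))
    with hbox
  have hbc : IsCompact box := isCompact_Icc
  refine hasSum_integral_of_summable_integral_norm
    (fun ab => (hc ab).continuousOn.integrableOn_compact hbc) ?_
  have hsW : Summable (fun ab : ((Fin m → ℤ) × (Fin q → ℤ)) × ((Fin q → ℤ) × (Fin n → ℤ)) =>
      (Real.exp (c₁ * (∑ i, x i ^ 2 + R)) * Real.exp (c₂ * (R + ∑ i, y i ^ 2)))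
        * (W₁ ab.1 * W₂ ab.2) * (volume : Measure ((Fin q → ℝ) × (Fin q → ℝ))).real box) :=
    ((hW₁.mul_of_nonneg hW₂ hW₁0 hW₂0).mul_left _).mul_right _
  refine Summable.of_nonneg_of_le (fun ab => integral_nonneg fun p => norm_nonneg _) (fun ab => ?_) hsW
  refine (Real.le_norm_self _).trans ?_
  refine norm_setIntegral_le_of_norm_le_const hbc.measure_lt_top ?_
  intro p hp
  have hps : ∑ i, p.1 i ^ 2 ≤ R := by
    refine Finset.sum_le_sum fun i _ => ?_
    have h0 : 0 ≤ p.1 i := hp.1.1 i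
    have h1 : p.1 i ≤ 2 * π := hp.2.1 i
    exact pow_le_pow_left₀ h0 h1 2
  rw [norm_norm, norm_mul]
  have b1 : ‖thTerm S₁ x ξ p.1 p.2 ab.1‖ ≤ Real.exp (c₁ * (∑ i, x i ^ 2 + R)) * W₁ ab.1 := by
    refine (hb₁ x ξ p.1 p.2 ab.1).trans (mul_le_mul_of_nonneg_right ?_ (hW₁0 _))
    apply Real.exp_le_exp.mpr
    apply mul_le_mul_of_nonneg_left _ hc₁.le
    linarith
  have b2 : ‖thTerm S₂ p.1 p.2 y η ab.2‖ ≤ Real.exp (c₂ * (R + ∑ i, y i ^ 2)) * W₂ ab.2 := by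
    refine (hb₂ p.1 p.2 y η ab.2).trans (mul_le_mul_of_nonneg_right ?_ (hW₂0 _))
    apply Real.exp_le_exp.mpr
    apply mul_le_mul_of_nonneg_left _ hc₂.le
    linarith
  calc _ ≤ (Real.exp (c₁ * (∑ i, x i ^ 2 + R)) * W₁ ab.1) *
        (Real.exp (c₂ * (R + ∑ i, y i ^ 2)) * W₂ ab.2) :=
      mul_le_mul b1 b2 (norm_nonneg _) (mul_nonneg (Real.exp_pos _).le (hW₁0 _))
    _ = _ := by ring

lemma kernel_int_eq {m n q : ℕ} (S₁ : Matrix (Fin m ⊕ Fin q) (Fin m ⊕ Fin q) ℂ)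
    (S₂ : Matrix (Fin q ⊕ Fin n) (Fin q ⊕ Fin n) ℂ)
    (S₃ : Matrix (Fin m ⊕ Fin n) (Fin m ⊕ Fin n) ℂ)
    (hneg₁ : (-(S₁.map Complex.re)).PosDef)
    (hneg₂ : (-(S₂.map Complex.re)).PosDef) (lam : ℂ)
    (hg : ∀ (X : Fin m → ℝ) (Y : Fin n → ℝ),
      ∫ s : Fin q → ℝ, Complex.exp ((1 / 2 : ℂ) * qf S₁ X s) * Complex.exp ((1 / 2 : ℂ) * qf S₂ s Y)
      = (((2 * π) ^ ((q : ℝ) / 2) : ℝ) : ℂ) * lam * Complex.exp ((1 / 2 : ℂ) * qf S₃ X Y))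
    (x ξ : Fin m → ℝ) (y η : Fin n → ℝ) :
    (∫ p in Set.Icc ((0, 0) : (Fin q → ℝ) × (Fin q → ℝ)) ((fun _ => 2 * π), (fun _ => 2 * π)),
        thetaKernel S₁ x ξ p.1 p.2 * thetaKernel S₂ p.1 p.2 y η)
      = (((2 * π) ^ (3 * (q : ℝ) / 2) : ℝ) : ℂ) * lam * thetaKernel S₃ x ξ y η := by
  have hs := kernel_int S₁ S₂ hneg₁ hneg₂ x ξ y η
  set φ : ((Fin m → ℤ) × (Fin n → ℤ)) × (Fin q → ℤ) →
      ((Fin m → ℤ) × (Fin q → ℤ)) × ((Fin q → ℤ) × (Fin n → ℤ)) :=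
    fun t => ((t.1.1, t.2), (t.2, t.1.2)) with hφ
  have hinj : Function.Injective φ := by
    rintro ⟨⟨a, b⟩, c⟩ ⟨⟨a', b'⟩, c'⟩ h
    simp only [hφ, Prod.mk.injEq] at h ⊢
    tauto
  have hz : ∀ t ∉ Set.range φ, (fun ab : ((Fin m → ℤ) × (Fin q → ℤ)) × ((Fin q → ℤ) × (Fin n → ℤ)) =>
      ∫ p in Set.Icc ((0, 0) : (Fin q → ℝ) × (Fin q → ℝ)) ((fun _ => 2 * π), (fun _ => 2 * π)),
        thTerm S₁ x ξ p.1 p.2 ab.1 * thTerm S₂ p.1 p.2 y η ab.2) t = 0 := by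
    rintro ⟨⟨k, l⟩, ⟨l', j⟩⟩ ht
    simp only [term_int]
    rw [if_neg, mul_zero, mul_zero]
    rintro rfl
    exact ht ⟨((k, j), l), rfl⟩
  rw [← hinj.hasSum_iff hz] at hs
  have hfib := hs.prod_fiberwise (g := fun kj : (Fin m → ℤ) × (Fin n → ℤ) =>
    (((2 * π) ^ (3 * (q : ℝ) / 2) : ℝ) : ℂ) * lam * thTerm S₃ x ξ y η kj) (by
      rintro ⟨k, j⟩
      simp only [Function.comp_apply, hφ, term_int, if_true]
      have hu := unfold_sum _ (integrable_F S₁ S₂ hneg₁ hneg₂ (fun i => x i + 2 * π * k i)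
        (fun i => y i + 2 * π * j i))
      rw [hg] at hu
      have hu2 := (hu.mul_right ((2 * π : ℂ) ^ q)).mul_left
        (Complex.exp (Complex.I * ∑ i, (k i : ℂ) * (ξ i : ℂ)) *
        Complex.exp (-Complex.I * ∑ i, (j i : ℂ) * (η i : ℂ)))
      have hpow : (((2 * π) ^ (3 * (q : ℝ) / 2) : ℝ) : ℂ)
          = (((2 * π) ^ ((q : ℝ) / 2) : ℝ) : ℂ) * (2 * π : ℂ) ^ q := by
        have : ((2 * π) ^ (3 * (q : ℝ) / 2) : ℝ) = (2 * π) ^ ((q : ℝ) / 2) * (2 * π) ^ q := by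
          rw [← Real.rpow_natCast, ← Real.rpow_add (by positivity)]
          congr 1; ring
        rw [this]; push_cast; rfl
      rw [hpow]
      have hval : (((2 * π) ^ ((q : ℝ) / 2) : ℝ) : ℂ) * (2 * π : ℂ) ^ q * lam
          * thTerm S₃ x ξ y η (k, j) = (Complex.exp (Complex.I * ∑ i, (k i : ℂ) * (ξ i : ℂ)) *
        Complex.exp (-Complex.I * ∑ i, (j i : ℂ) * (η i : ℂ))) *
          ((((2 * π) ^ ((q : ℝ) / 2) : ℝ) : ℂ) * lam * Complex.exp ((1 / 2 : ℂ) *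
            qf S₃ (fun i => x i + 2 * π * k i) (fun i => y i + 2 * π * j i)) * (2 * π : ℂ) ^ q) := by
        simp only [thTerm]
        ring
      rw [hval]
      exact hu2)
  rw [← hfib.tsum_eq, tsum_mul_left]
  rfl

lemma op_comp {m n q : ℕ} (S₁ : Matrix (Fin m ⊕ Fin q) (Fin m ⊕ Fin q) ℂ)
    (S₂ : Matrix (Fin q ⊕ Fin n) (Fin q ⊕ Fin n) ℂ)
    (S₃ : Matrix (Fin m ⊕ Fin n) (Fin m ⊕ Fin n) ℂ)
    (hneg₁ : (-(S₁.map Complex.re)).PosDef)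
    (hneg₂ : (-(S₂.map Complex.re)).PosDef) (lam : ℂ)
    (hk : ∀ (x ξ : Fin m → ℝ) (y η : Fin n → ℝ),
      (∫ p in Set.Icc ((0, 0) : (Fin q → ℝ) × (Fin q → ℝ)) ((fun _ => 2 * π), (fun _ => 2 * π)),
        thetaKernel S₁ x ξ p.1 p.2 * thetaKernel S₂ p.1 p.2 y η)
      = (((2 * π) ^ (3 * (q : ℝ) / 2) : ℝ) : ℂ) * lam * thetaKernel S₃ x ξ y η)
    (g : (Fin n → ℝ) → (Fin n → ℝ) → ℂ)
    (hgc : Continuous (fun p : (Fin n → ℝ) × (Fin n → ℝ) => g p.1 p.2)) (x ξ : Fin m → ℝ) :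
    thetaOp S₁ (fun s ζ => thetaOp S₂ g s ζ) x ξ = lam * thetaOp S₃ g x ξ := by
  simp only [thetaOp]
  set bq := Set.Icc ((0, 0) : (Fin q → ℝ) × (Fin q → ℝ)) ((fun _ => 2 * π), (fun _ => 2 * π)) with hbq
  set bn := Set.Icc ((0, 0) : (Fin n → ℝ) × (Fin n → ℝ)) ((fun _ => 2 * π), (fun _ => 2 * π)) with hbn
  set c₁ : ℂ := (((2 * π) ^ (-(3 * ((q : ℝ) + m) / 4)) : ℝ) : ℂ) with hc₁
  set c₂ : ℂ := (((2 * π) ^ (-(3 * ((n : ℝ) + q) / 4)) : ℝ) : ℂ) with hc₂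
  set c₃ : ℂ := (((2 * π) ^ (-(3 * ((n : ℝ) + m) / 4)) : ℝ) : ℂ) with hc₃
  have hpow : c₁ * c₂ * (((2 * π) ^ (3 * (q : ℝ) / 2) : ℝ) : ℂ) = c₃ := by
    rw [hc₁, hc₂, hc₃, ← Complex.ofReal_mul, ← Complex.ofReal_mul,
      ← Real.rpow_add (by positivity), ← Real.rpow_add (by positivity)]
    congr 2; ring
  have e1 : ∀ p : (Fin q → ℝ) × (Fin q → ℝ),
      thetaKernel S₁ x ξ p.1 p.2 * (c₂ * ∫ r in bn, thetaKernel S₂ p.1 p.2 r.1 r.2 * g r.1 r.2)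
      = c₂ * ∫ r in bn, thetaKernel S₁ x ξ p.1 p.2 * thetaKernel S₂ p.1 p.2 r.1 r.2 * g r.1 r.2 := by
    intro p
    simp only [mul_assoc]
    rw [integral_const_mul]
    ring
  simp only [e1]
  rw [integral_const_mul]
  have hint : Integrable (Function.uncurry fun (p : (Fin q → ℝ) × (Fin q → ℝ))
      (r : (Fin n → ℝ) × (Fin n → ℝ)) =>
      thetaKernel S₁ x ξ p.1 p.2 * thetaKernel S₂ p.1 p.2 r.1 r.2 * g r.1 r.2)
      ((volume.restrict bq).prod (volume.restrict bn)) := by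
    rw [Measure.prod_restrict]
    refine ContinuousOn.integrableOn_compact (isCompact_Icc.prod isCompact_Icc) ?_
    apply Continuous.continuousOn
    refine Continuous.mul (Continuous.mul ?_ ?_) ?_
    · exact (cont_kernel S₁ hneg₁).comp
        (f := fun t : ((Fin q → ℝ) × (Fin q → ℝ)) × ((Fin n → ℝ) × (Fin n → ℝ)) => ((x, ξ), t.1))
        (by fun_prop)
    · exact cont_kernel S₂ hneg₂
    · exact hgc.comp continuous_snd
  rw [integral_integral_swap hint]
  simp only [integral_mul_const, hk]
  simp only [mul_assoc]
  rw [integral_const_mul, integral_const_mul, ← hpow]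
  ring

/-- composition law for integral operators with theta-kernels. -/
theorem thetaKernel_comp (m n q : ℕ)
    (A : Matrix (Fin m) (Fin m) ℂ) (B : Matrix (Fin m) (Fin q) ℂ)
    (C : Matrix (Fin q) (Fin q) ℂ)
    (K : Matrix (Fin q) (Fin q) ℂ) (L : Matrix (Fin q) (Fin n) ℂ)
    (M : Matrix (Fin n) (Fin n) ℂ)
    (S₁ : Matrix (Fin m ⊕ Fin q) (Fin m ⊕ Fin q) ℂ)
    (S₂ : Matrix (Fin q ⊕ Fin n) (Fin q ⊕ Fin n) ℂ)
    (S₃ : Matrix (Fin m ⊕ Fin n) (Fin m ⊕ Fin n) ℂ)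
    (hS₁ : S₁ = Matrix.fromBlocks A B Bᵀ C)
    (hS₂ : S₂ = Matrix.fromBlocks K L Lᵀ M)
    (hS₃ : S₃ = Matrix.fromBlocks
      (A - B * (C + K)⁻¹ * Bᵀ) (-(B * (C + K)⁻¹ * L))
      (-(Lᵀ * (C + K)⁻¹ * Bᵀ)) (M - Lᵀ * (C + K)⁻¹ * L))
    (hsym₁ : S₁ᵀ = S₁) (hsym₂ : S₂ᵀ = S₂)
    (hneg₁ : (-(S₁.map Complex.re)).PosDef)
    (hneg₂ : (-(S₂.map Complex.re)).PosDef) :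
    IsUnit (C + K) ∧
    S₃ᵀ = S₃ ∧ (-(S₃.map Complex.re)).PosDef ∧
    ∃ lam : ℂ, lam ^ 2 = ((-(C + K)).det)⁻¹ ∧
      (∀ (x ξ : Fin m → ℝ) (y η : Fin n → ℝ),
        (∫ p in Set.Icc ((0, 0) : (Fin q → ℝ) × (Fin q → ℝ))
            ((fun _ => 2 * π), (fun _ => 2 * π)),
          thetaKernel S₁ x ξ p.1 p.2 * thetaKernel S₂ p.1 p.2 y η)
        = (((2 * π) ^ (3 * (q : ℝ) / 2) : ℝ) : ℂ) * lam * thetaKernel S₃ x ξ y η) ∧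
      (∀ g : (Fin n → ℝ) → (Fin n → ℝ) → ℂ,
        Continuous (fun p : (Fin n → ℝ) × (Fin n → ℝ) => g p.1 p.2) →
        ∀ x ξ : Fin m → ℝ,
          thetaOp S₁ (fun s ζ => thetaOp S₂ g s ζ) x ξ = lam * thetaOp S₃ g x ξ) := by
  subst hS₁ hS₂ hS₃
  obtain ⟨hs, hs3⟩ := S3_symm hsym₁ hsym₂
  obtain ⟨lam, hl, hg⟩ := gauss_comp hsym₁ hsym₂ hneg₁ hneg₂
  have hk := kernel_int_eq _ _ _ hneg₁ hneg₂ lam hg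
  refine ⟨(Matrix.isUnit_iff_isUnit_det _).mpr (CK_unit hsym₁ hsym₂ hneg₁ hneg₂), hs3,
    posdef_of_cv _ hs3 ?_, lam, hl, hk, fun g hgc x ξ => op_comp _ _ _ hneg₁ hneg₂ lam hk g hgc x ξ⟩
  intro v hv
  have h := S3_neg hsym₁ hsym₂ hneg₁ hneg₂ hs (fun i => v (Sum.inl i)) (fun i => v (Sum.inr i))
  have he : Sum.elim (fun i => v (Sum.inl i)) (fun i => v (Sum.inr i)) = v := by
    ext i; cases i <;> rfl
  rw [he] at h
  exact h hv
end
end
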